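/- arXiv:1702.01914 — 3 statements merged into one kernel-verified Lean document; each statement's English description precedes it below -/
import Mathlib

section
/- Let Z ⊂ ℙᵐ (m ≥ 2) be a zero-dimensional scheme spanning ℙᵐ with deg(Z) ≤ d+1+m and h¹(I_Z(d)) > 0, where d ≥ 3. Then deg(Z) = d+1+m and there is a line L ⊂ ℙᵐ with deg(Z ∩ L) = d+2. -/
open MvPolynomial Module

/-- The (scheme-theoretic) ideal of the affine line `{p + t • v : t}` in `𝔸ᵐ`,
i.e. the kernel of the substitution `X i ↦ p i + v i * T`. -/
noncomputable def lineIdeal {k : Type*} [Field k] {n : ℕ} (p v : Fin n → k) :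
    Ideal (MvPolynomial (Fin n) k) :=
  RingHom.ker (MvPolynomial.aeval (R := k)
    (fun i => Polynomial.C (p i) + Polynomial.C (v i) * Polynomial.X) :
      MvPolynomial (Fin n) k →ₐ[k] Polynomial k)


section helpers

/-- Degree `≤ e` part of the coordinate ring. -/
noncomputable def VV {k : Type*} [Field k] {m : ℕ} (I : Ideal (MvPolynomial (Fin m) k)) (e : ℕ) :
    Submodule k (MvPolynomial (Fin m) k ⧸ I) :=
  Submodule.map (Ideal.Quotient.mkₐ k I).toLinearMap
      (MvPolynomial.restrictTotalDegree (Fin m) k e)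

variable {k : Type*} [Field k] {m : ℕ} (I : Ideal (MvPolynomial (Fin m) k))

lemma mk_mem_VV {e : ℕ} {f : MvPolynomial (Fin m) k} (hf : f.totalDegree ≤ e) :
    Ideal.Quotient.mkₐ k I f ∈ VV I e :=
  ⟨f, (mem_restrictTotalDegree _ _ _).2 hf, rfl⟩

lemma VV_mono {a b : ℕ} (h : a ≤ b) : VV I a ≤ VV I b := by
  rintro _ ⟨f, hf, rfl⟩
  exact mk_mem_VV I (((mem_restrictTotalDegree _ _ _).1 hf).trans h)

lemma VV_top {e : ℕ} (h : VV I (e+1) ≤ VV I e) : VV I e = ⊤ := by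
  have key : ∀ f : MvPolynomial (Fin m) k, Ideal.Quotient.mkₐ k I f ∈ VV I e := by
    intro f
    induction f using MvPolynomial.induction_on with
    | C a => exact mk_mem_VV I (by simp)
    | add p q hp hq => rw [map_add]; exact add_mem hp hq
    | mul_X p i hp =>
      obtain ⟨g, hg, hgp⟩ := hp
      apply h
      rw [map_mul, ← hgp]
      have := (mem_restrictTotalDegree _ _ _).1 hg
      have h2 : (g * X i).totalDegree ≤ e + 1 :=
        (totalDegree_mul _ _).trans (by rw [totalDegree_X]; omega)
      have h3 := mk_mem_VV I h2
      rwa [map_mul] at h3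
  rw [eq_top_iff]
  rintro x -
  obtain ⟨f, rfl⟩ := Ideal.Quotient.mkₐ_surjective k I x
  exact key f

lemma VV_growth [FiniteDimensional k (MvPolynomial (Fin m) k ⧸ I)] {d : ℕ} (h : VV I d ≠ ⊤)
    (a n : ℕ) (hn : a + n ≤ d + 1) :
    finrank k (VV I a) + n ≤ finrank k (VV I (a + n)) := by
  induction n with
  | zero => simp
  | succ n ih =>
    have h1 := ih (by omega)
    have h2 : VV I (a+n) < VV I (a+n+1) := by
      refine lt_of_le_of_ne (VV_mono I (by omega)) fun heq => ?_
      have := VV_top I heq.ge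
      exact h (top_le_iff.1 (this.ge.trans (VV_mono I (by omega))))
    have h3 := Submodule.finrank_lt_finrank_of_lt h2
    rw [← add_assoc a]
    omega

lemma VV_zero_pos [FiniteDimensional k (MvPolynomial (Fin m) k ⧸ I)] {d : ℕ} (h : VV I d ≠ ⊤) :
    1 ≤ finrank k (VV I 0) := by
  rw [Submodule.one_le_finrank_iff]
  intro h0
  have h1 : Ideal.Quotient.mkₐ k I 1 ∈ VV I 0 := mk_mem_VV I (by simp)
  rw [h0, Submodule.mem_bot, map_one] at h1
  apply h
  rw [eq_top_iff]
  rintro x -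
  have : x = 0 := by rw [← mul_one x, h1, mul_zero]
  rw [this]; exact zero_mem _

/-- affine linear forms -/
noncomputable def aff (k : Type*) [Field k] (m : ℕ) :
    (k × (Fin m → k)) →ₗ[k] MvPolynomial (Fin m) k where
  toFun x := C x.1 + ∑ i, C (x.2 i) * X i
  map_add' x y := by simp [add_mul, Finset.sum_add_distrib]; ring
  map_smul' r x := by simp [MvPolynomial.smul_eq_C_mul, Finset.mul_sum, mul_add, mul_assoc]

lemma aff_deg (x : k × (Fin m → k)) : (aff k m x).totalDegree ≤ 1 := by
  refine (totalDegree_add _ _).trans (max_le (by simp) ?_)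
  refine (totalDegree_finsetSum _ _).trans (Finset.sup_le fun i _ => ?_)
  exact (totalDegree_mul _ _).trans (by simp [totalDegree_X])

lemma aff_inj (hspan : ∀ (c : k) (a : Fin m → k),
      (MvPolynomial.C c + ∑ i, MvPolynomial.C (a i) * MvPolynomial.X i) ∈ I → c = 0 ∧ a = 0) :
    LinearMap.ker ((Ideal.Quotient.mkₐ k I).toLinearMap ∘ₗ aff k m) = ⊥ := by
  rw [LinearMap.ker_eq_bot']
  rintro ⟨c, a⟩ h
  have := hspan c a (Ideal.Quotient.eq_zero_iff_mem.1 h)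
  exact Prod.ext this.1 this.2

lemma VV_one [FiniteDimensional k (MvPolynomial (Fin m) k ⧸ I)]
    (hspan : ∀ (c : k) (a : Fin m → k),
      (MvPolynomial.C c + ∑ i, MvPolynomial.C (a i) * MvPolynomial.X i) ∈ I → c = 0 ∧ a = 0) :
    m + 1 ≤ finrank k (VV I 1) := by
  have h := aff_inj I hspan
  have h2 := LinearMap.finrank_range_of_inj (LinearMap.ker_eq_bot.1 h)
  have h3 : LinearMap.range ((Ideal.Quotient.mkₐ k I).toLinearMap ∘ₗ aff k m) ≤ VV I 1 := by
    rintro _ ⟨x, rfl⟩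
    exact mk_mem_VV I (aff_deg x)
  have h4 := Submodule.finrank_mono h3
  rw [h2] at h4
  simp at h4
  omega

/-- substitution along the line -/
lemma line_le {J : Ideal (MvPolynomial (Fin m) k)} {p v : Fin m → k} {T : MvPolynomial (Fin m) k}
    (h : ∀ i, X i - (C (p i) + C (v i) * T) ∈ J) (f : MvPolynomial (Fin m) k) :
    f - Polynomial.aeval T (MvPolynomial.aeval (R := k)
      (fun i => Polynomial.C (p i) + Polynomial.C (v i) * Polynomial.X) f) ∈ J := by
  rw [← Ideal.Quotient.eq_zero_iff_mem, map_sub, sub_eq_zero]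
  have : (Ideal.Quotient.mkₐ k J) = (Ideal.Quotient.mkₐ k J).comp ((Polynomial.aeval T).comp
      (MvPolynomial.aeval (R := k)
      (fun i => Polynomial.C (p i) + Polynomial.C (v i) * Polynomial.X))) := by
    apply MvPolynomial.algHom_ext
    intro i
    have h2 := Ideal.Quotient.eq_zero_iff_mem.2 (h i)
    rw [map_sub, sub_eq_zero] at h2
    simpa [MvPolynomial.algebraMap_eq] using h2
  exact DFunLike.congr_fun this f

lemma line_upper [FiniteDimensional k (MvPolynomial (Fin m) k ⧸ I)]
    (hspan : ∀ (c : k) (a : Fin m → k),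
      (MvPolynomial.C c + ∑ i, MvPolynomial.C (a i) * MvPolynomial.X i) ∈ I → c = 0 ∧ a = 0)
    (p v : Fin m → k) :
    finrank k (MvPolynomial (Fin m) k ⧸ (I ⊔ lineIdeal p v)) + m ≤
      finrank k (MvPolynomial (Fin m) k ⧸ I) + 1 := by
  let q : (MvPolynomial (Fin m) k ⧸ I) →ₗ[k] (MvPolynomial (Fin m) k ⧸ (I ⊔ lineIdeal p v)) :=
    (Ideal.Quotient.factorₐ k (le_sup_left : I ≤ I ⊔ lineIdeal p v)).toLinearMap
  have hq : Function.Surjective q := Ideal.Quotient.factor_surjective le_sup_left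
  have h1 := LinearMap.finrank_range_add_finrank_ker q
  rw [LinearMap.range_eq_top.2 hq, finrank_top] at h1
  let ev : (k × (Fin m → k)) →ₗ[k] (k × k) :=
    { toFun := fun x => (x.1 + ∑ i, x.2 i * p i, ∑ i, x.2 i * v i)
      map_add' := fun x y => by
        simp [add_mul, Finset.sum_add_distrib]; ring
      map_smul' := fun r x => by simp [Finset.mul_sum, mul_add, mul_assoc] }
  have h2 := LinearMap.finrank_range_add_finrank_ker ev
  have h3 := Submodule.finrank_le (LinearMap.range ev)
  simp at h2 h3
  let F := (Ideal.Quotient.mkₐ k I).toLinearMap ∘ₗ aff k m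
  have hF : Function.Injective F := LinearMap.ker_eq_bot.1 (aff_inj I hspan)
  have h4 : (LinearMap.ker ev).map F ≤ LinearMap.ker q := by
    rintro _ ⟨x, hx, rfl⟩
    have hx' : ev x = 0 := hx
    rw [LinearMap.mem_ker]
    change Ideal.Quotient.mk (I ⊔ lineIdeal p v) (aff k m x) = 0
    rw [Ideal.Quotient.eq_zero_iff_mem]
    apply Ideal.mem_sup_right
    rw [lineIdeal, RingHom.mem_ker]
    have e1 : x.1 + ∑ i, x.2 i * p i = 0 := congrArg Prod.fst hx'
    have e2 : ∑ i, x.2 i * v i = 0 := congrArg Prod.snd hx'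
    have : (MvPolynomial.aeval (R := k)
      (fun i => Polynomial.C (p i) + Polynomial.C (v i) * Polynomial.X)) (aff k m x)
      = Polynomial.C (x.1 + ∑ i, x.2 i * p i) + Polynomial.C (∑ i, x.2 i * v i) * Polynomial.X := by
      simp [aff, mul_add, Finset.sum_add_distrib, Finset.sum_mul, mul_assoc, add_assoc,
        MvPolynomial.algebraMap_eq, Polynomial.algebraMap_eq]
    rw [this, e1, e2]; simp
  have h5 := Submodule.finrank_mono h4
  rw [← (Submodule.equivMapOfInjective F hF (LinearMap.ker ev)).finrank_eq] at h5
  omega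

lemma exists_span_pair {E F : Type*} [AddCommGroup E] [Module k E] [AddCommGroup F] [Module k F]
    [FiniteDimensional k F] (g : E →ₗ[k] F) (S : Submodule k E) (hS : finrank k (S.map g) ≤ 2)
    (e : E) (he : e ∈ S) (hge : g e ≠ 0) :
    ∃ T ∈ S, ∀ x ∈ S, ∃ a b : k, g x = a • g e + b • g T := by
  by_cases h : ∀ x ∈ S, g x ∈ Submodule.span k {g e}
  · refine ⟨0, zero_mem _, fun x hx => ?_⟩
    obtain ⟨a, ha⟩ := Submodule.mem_span_singleton.1 (h x hx)
    exact ⟨a, 0, by simp [ha]⟩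
  · push Not at h
    obtain ⟨T, hT, hTn⟩ := h
    refine ⟨T, hT, fun x hx => ?_⟩
    have hli : LinearIndependent k ![g e, g T] := by
      rw [LinearIndependent.pair_iff' hge]
      intro a ha
      exact hTn (Submodule.mem_span_singleton.2 ⟨a, ha⟩)
    have hr := finrank_span_eq_card hli
    have hle : Submodule.span k (Set.range ![g e, g T]) ≤ S.map g := by
      rw [Submodule.span_le]
      rintro _ ⟨i, rfl⟩
      fin_cases i
      · exact ⟨e, he, rfl⟩
      · exact ⟨T, hT, rfl⟩
    have heq := Submodule.eq_of_le_of_finrank_le hle (by rw [hr]; simpa using hS)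
    have hx2 : g x ∈ S.map g := ⟨x, hx, rfl⟩
    rw [← heq] at hx2
    simp only [Matrix.range_cons, Matrix.range_empty, Set.union_empty, Set.singleton_union] at hx2
    obtain ⟨a, b, hab⟩ := Submodule.mem_span_pair.1 hx2
    exact ⟨a, b, hab.symm⟩

end helpers

/-- Let `Z ⊂ ℙᵐ` (`m ≥ 2`) be a zero-dimensional scheme (in an affine chart, cut out by an
ideal `I` with finite-dimensional coordinate ring) spanning `ℙᵐ` (no nonzero affine-linear
form lies in `I`), with `deg Z ≤ d+1+m` and `h¹(I_Z(d)) > 0` (the restriction of the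
polynomials of degree `≤ d` to `Z` is not surjective), where `d ≥ 3`.  Then
`deg Z = d+1+m` and there is a line `L` with `deg(Z ∩ L) = d+2`. -/
theorem stmt9 (k : Type*) [Field k] [IsAlgClosed k] [CharZero k] (m d : ℕ)
    (hm : 2 ≤ m) (hd : 3 ≤ d)
    (I : Ideal (MvPolynomial (Fin m) k))
    [FiniteDimensional k (MvPolynomial (Fin m) k ⧸ I)]
    (hspan : ∀ (c : k) (a : Fin m → k),
      (MvPolynomial.C c + ∑ i, MvPolynomial.C (a i) * MvPolynomial.X i) ∈ I → c = 0 ∧ a = 0)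
    (hdeg : finrank k (MvPolynomial (Fin m) k ⧸ I) ≤ d + 1 + m)
    (h1 : Submodule.map (Ideal.Quotient.mkₐ k I).toLinearMap
      (MvPolynomial.restrictTotalDegree (Fin m) k d) ≠ ⊤) :
    finrank k (MvPolynomial (Fin m) k ⧸ I) = d + 1 + m ∧
    ∃ (p v : Fin m → k), v ≠ 0 ∧
      finrank k (MvPolynomial (Fin m) k ⧸ (I ⊔ lineIdeal p v)) = d + 2 := by
  classical
  change VV I d ≠ ⊤ at h1
  have hg1 := VV_growth I h1 1 d (by omega)
  have hg2 := VV_growth I h1 1 (d - 2) (by omega)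
  have hV1 := VV_one I hspan
  have hle := Submodule.finrank_le (VV I (1 + d))
  have hdim : finrank k (MvPolynomial (Fin m) k ⧸ I) = d + 1 + m := by omega
  refine ⟨hdim, ?_⟩
  rw [show 1 + (d - 2) = d - 1 by omega] at hg2
  obtain ⟨φ, hφ0, hφ⟩ := Submodule.exists_le_ker_of_lt_top _ (lt_top_iff_ne_top.2 h1)
  -- the pairing
  obtain ⟨ψ, hψ⟩ : ∃ ψ : MvPolynomial (Fin m) k →ₗ[k] Dual k (MvPolynomial (Fin m) k ⧸ I),
      ∀ f x, ψ f x = φ (Ideal.Quotient.mkₐ k I f * x) :=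
    ⟨{ toFun := fun f => φ ∘ₗ LinearMap.mulLeft k (Ideal.Quotient.mkₐ k I f)
       map_add' := fun f g => LinearMap.ext fun x => by
         simp only [LinearMap.comp_apply, LinearMap.mulLeft_apply, map_add, add_mul,
           LinearMap.add_apply]
       map_smul' := fun r f => LinearMap.ext fun x => by
         simp only [LinearMap.comp_apply, LinearMap.mulLeft_apply, map_smul, smul_mul_assoc,
           LinearMap.smul_apply, RingHom.id_apply] }, fun f x => rfl⟩
  obtain ⟨J, hJ⟩ : ∃ J : Ideal (MvPolynomial (Fin m) k), ∀ f, f ∈ J ↔ ψ f = 0 :=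
    ⟨{ carrier := {f | ψ f = 0}
       add_mem' := fun {a b} ha hb => by
         simp only [Set.mem_setOf_eq] at *
         rw [map_add, ha, hb, add_zero]
       zero_mem' := map_zero ψ
       smul_mem' := fun c f hf => by
         have hf' : ψ f = 0 := hf
         change ψ (c * f) = 0
         refine LinearMap.ext fun x => ?_
         have := LinearMap.congr_fun hf' (Ideal.Quotient.mkₐ k I c * x)
         rw [hψ, LinearMap.zero_apply] at this
         rw [hψ, map_mul (Ideal.Quotient.mkₐ k I), mul_comm (Ideal.Quotient.mkₐ k I c), mul_assoc, this,
           LinearMap.zero_apply] }, fun f => Iff.rfl⟩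
  have hIJ : I ≤ J := by
    intro f hf
    rw [hJ]
    refine LinearMap.ext fun x => ?_
    have : Ideal.Quotient.mkₐ k I f = 0 := Ideal.Quotient.eq_zero_iff_mem.2 hf
    rw [hψ, this, zero_mul, map_zero, LinearMap.zero_apply]
  have hψ1 : ψ 1 = φ := by
    refine LinearMap.ext fun x => ?_
    rw [hψ, map_one, one_mul]
  have hJφ : ∀ f ∈ J, φ (Ideal.Quotient.mkₐ k I f) = 0 := by
    intro f hf
    have := LinearMap.congr_fun ((hJ f).1 hf) 1
    rw [hψ, mul_one] at this
    simpa using this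
  have hrank : finrank k ((restrictTotalDegree (Fin m) k 1).map ψ) ≤ 2 := by
    have h3 : (restrictTotalDegree (Fin m) k 1).map ψ ≤ (VV I (d-1)).dualAnnihilator := by
      rintro _ ⟨f, hf, rfl⟩
      rw [Submodule.mem_dualAnnihilator]
      rintro _ ⟨g, hg, rfl⟩
      have hf' := (mem_restrictTotalDegree _ _ _).1 hf
      have hg' := (mem_restrictTotalDegree _ _ _).1 hg
      rw [hψ]
      have h4 : (f * g).totalDegree ≤ d := (totalDegree_mul _ _).trans (by omega)
      have h5 := hφ (mk_mem_VV I h4)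
      rwa [map_mul] at h5
    have h4 := Submodule.finrank_mono h3
    have h5 := Subspace.finrank_add_finrank_dualAnnihilator_eq (VV I (d-1))
    omega
  obtain ⟨T, hT, hTs⟩ := exists_span_pair ψ (restrictTotalDegree (Fin m) k 1) hrank 1
    ((mem_restrictTotalDegree _ _ _).2 (by simp)) (by rw [hψ1]; exact hφ0)
  choose p v hpv using fun i : Fin m => hTs (X i) ((mem_restrictTotalDegree _ _ _).2
    (by rw [totalDegree_X]))
  have hX : ∀ i, X i - (C (p i) + C (v i) * T) ∈ J := by
    intro i
    rw [hJ]
    have : (C (p i) + C (v i) * T : MvPolynomial (Fin m) k) = p i • 1 + v i • T := by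
      simp [MvPolynomial.smul_eq_C_mul]
    rw [this, map_sub, map_add, map_smul, map_smul, hpv, sub_self]
  have hline : lineIdeal p v ≤ J := by
    intro f hf
    have h2 := line_le hX f
    rw [lineIdeal, RingHom.mem_ker] at hf
    rwa [hf, map_zero, sub_zero] at h2
  refine ⟨p, v, ?_, ?_⟩
  · intro hv
    apply hφ0
    refine LinearMap.ext fun x => ?_
    obtain ⟨f, rfl⟩ := Ideal.Quotient.mkₐ_surjective k I x
    have h2 : f - C (MvPolynomial.eval p f) ∈ J := by
      have h3 := line_le hX f
      convert h3 using 2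
      have : MvPolynomial.aeval (R := k) (fun i => Polynomial.C (p i) +
          Polynomial.C (v i) * Polynomial.X) = (Algebra.ofId k (Polynomial k)).comp
            (MvPolynomial.aeval p) := by
        apply MvPolynomial.algHom_ext
        intro i
        simp [hv, Algebra.ofId_apply]
      rw [this]
      simp [Algebra.ofId_apply, MvPolynomial.aeval_eq_eval, MvPolynomial.algebraMap_eq]
    have h3 := hJφ _ h2
    have h4 : φ (Ideal.Quotient.mkₐ k I (C (MvPolynomial.eval p f))) = 0 :=
      hφ (mk_mem_VV I (by simp))
    rw [map_sub, map_sub, h4, sub_zero] at h3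
    simpa using h3
  · have hup := line_upper I hspan p v
    have hsup : I ⊔ lineIdeal p v ≤ J := sup_le hIJ hline
    haveI : FiniteDimensional k (MvPolynomial (Fin m) k ⧸ (I ⊔ lineIdeal p v)) :=
      Module.Finite.of_surjective
        (Ideal.Quotient.factorₐ k (le_sup_left : I ≤ I ⊔ lineIdeal p v)).toLinearMap
        (Ideal.Quotient.factor_surjective le_sup_left)
    have hne : VV (I ⊔ lineIdeal p v) d ≠ ⊤ := by
      intro htop
      apply hφ0
      refine LinearMap.ext fun x => ?_
      obtain ⟨f, rfl⟩ := Ideal.Quotient.mkₐ_surjective k I x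
      have hf : Ideal.Quotient.mkₐ k (I ⊔ lineIdeal p v) f ∈ VV (I ⊔ lineIdeal p v) d := by
        rw [htop]; trivial
      obtain ⟨g, hg, hgf⟩ := hf
      have h2 : g - f ∈ J := hsup (Ideal.Quotient.eq.1 hgf)
      have h3 := hJφ _ h2
      have h4 : φ (Ideal.Quotient.mkₐ k I g) = 0 :=
        hφ (mk_mem_VV I ((mem_restrictTotalDegree _ _ _).1 hg))
      rw [map_sub, map_sub, h4, zero_sub, neg_eq_zero] at h3
      simpa using h3
    have h2 := VV_growth _ hne 0 (d+1) (by omega)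
    have h3 := VV_zero_pos _ hne
    have h4 := Submodule.finrank_le (VV (I ⊔ lineIdeal p v) (0 + (d + 1)))
    omega
end

section
/- Fix an integer d ≥ 6 and m ≥ 2. Let Z ⊂ ℙᵐ be a zero-dimensional scheme with deg(Z) ≤ 3d+1 and h¹(I_Z(d)) > 0. Then either there is a line L with deg(L ∩ Z) ≥ d+2, or a conic T with deg(T ∩ Z) ≥ 2d+2, or a plane cubic F with deg(F ∩ Z) ≥ 3d. -/
open MvPolynomial Module

/-- The (scheme-theoretic) ideal of the plane curve `{q = 0}` inside the affine plane
`{p + s • v₁ + t • v₂}` of `𝔸ᵐ`: the preimage of the principal ideal `(q)` under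
restriction of polynomial functions to the (parametrized) plane. -/
noncomputable def planeCurveIdeal {k : Type*} [Field k] {n : ℕ} (p v₁ v₂ : Fin n → k)
    (q : MvPolynomial (Fin 2) k) : Ideal (MvPolynomial (Fin n) k) :=
  Ideal.comap (MvPolynomial.aeval (R := k)
    (fun i => MvPolynomial.C (p i) + MvPolynomial.C (v₁ i) * MvPolynomial.X 0 +
      MvPolynomial.C (v₂ i) * MvPolynomial.X 1) :
      MvPolynomial (Fin n) k →ₐ[k] MvPolynomial (Fin 2) k)
    (Ideal.span {q})


section General

theorem finrank_map_inj {k V V₂ : Type*} [Field k] [AddCommGroup V] [Module k V] [AddCommGroup V₂]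
    [Module k V₂] (l : V →ₗ[k] V₂) (hl : Function.Injective l) (S : Submodule k V) :
    finrank k (S.map l) = finrank k S :=
  (Submodule.equivMapOfInjective l hl S).finrank_eq.symm

theorem rankNull {k V V₂ : Type*} [Field k] [AddCommGroup V] [Module k V] [AddCommGroup V₂]
    [Module k V₂] (S : Submodule k V) [FiniteDimensional k S] (l : V →ₗ[k] V₂) :
    finrank k (S.map l) + finrank k (S ⊓ LinearMap.ker l : Submodule k V) = finrank k S := by
  have h := LinearMap.finrank_range_add_finrank_ker (l.domRestrict S)
  rw [LinearMap.range_domRestrict] at h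
  have e : (LinearMap.ker (l.domRestrict S)).map S.subtype = S ⊓ LinearMap.ker l := by
    ext x
    simp only [Submodule.mem_map, LinearMap.mem_ker, LinearMap.domRestrict_apply,
      Submodule.subtype_apply, Submodule.mem_inf]
    constructor
    · rintro ⟨y, hy, rfl⟩
      exact ⟨y.2, hy⟩
    · rintro ⟨hx, hl⟩
      exact ⟨⟨x, hx⟩, hl, rfl⟩
  rw [← e, finrank_map_inj _ S.injective_subtype]
  exact h

/-- An intersection is nonzero for dimension reasons. -/
theorem exists_inf {k V : Type*} [Field k] [AddCommGroup V] [Module k V] [FiniteDimensional k V]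
    (S T X : Submodule k V) (hS : S ≤ X) (hT : T ≤ X)
    (h : finrank k X < finrank k S + finrank k T) : ∃ x, x ∈ S ∧ x ∈ T ∧ x ≠ 0 := by
  have h1 := Submodule.finrank_sup_add_finrank_inf_eq S T
  have h2 : finrank k (S ⊔ T : Submodule k V) ≤ finrank k X := Submodule.finrank_mono (sup_le hS hT)
  have h3 : (S ⊓ T) ≠ ⊥ := by
    intro h0
    rw [h0, finrank_bot] at h1
    omega
  obtain ⟨x, hx, hx0⟩ := Submodule.exists_mem_ne_zero_of_ne_bot h3
  exact ⟨x, hx.1, hx.2, hx0⟩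

theorem exists_ne_of_finrank {k V : Type*} [Field k] [AddCommGroup V] [Module k V]
    (S : Submodule k V) (h : 0 < finrank k S) : ∃ x ∈ S, x ≠ 0 := by
  apply Submodule.exists_mem_ne_zero_of_ne_bot
  rintro rfl
  simp at h

/-- dimension of an ideal -/
noncomputable def dI (k : Type*) {B : Type*} [Field k] [CommRing B] [Algebra k B] (J : Ideal B) : ℕ :=
  finrank k (J.restrictScalars k)

/-- annihilator of an element -/
def annI {B : Type*} [CommRing B] (f : B) : Ideal B where
  carrier := {x | f * x = 0}
  add_mem' := by
    intro a b ha hb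
    simp only [Set.mem_ofPred_eq] at *
    rw [mul_add, ha, hb, add_zero]
  zero_mem' := by simp
  smul_mem' := by
    intro c x hx
    simp only [Set.mem_ofPred_eq, smul_eq_mul] at *
    rw [mul_left_comm, hx, mul_zero]

theorem mem_annI {B : Type*} [CommRing B] {f x : B} : x ∈ annI f ↔ f * x = 0 := Iff.rfl

variable {k B : Type*} [Field k] [CommRing B] [Algebra k B]

/-- degree of the residual scheme -/
noncomputable def NN (k : Type*) {B : Type*} [Field k] [CommRing B] [Algebra k B] (g : B) : ℕ :=
  dI k (Ideal.span {g})

theorem dI_mono [FiniteDimensional k B] {J J' : Ideal B} (h : J ≤ J') : dI k J ≤ dI k J' :=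
  Submodule.finrank_mono (s := J.restrictScalars k) (t := J'.restrictScalars k) h

theorem eq_of_dI [FiniteDimensional k B] {J J' : Ideal B} (h : J ≤ J') (h2 : dI k J' ≤ dI k J) :
    J = J' := by
  have := Submodule.eq_of_le_of_finrank_le (S₁ := J.restrictScalars k)
    (S₂ := J'.restrictScalars k) h h2
  exact Submodule.restrictScalars_injective k B B this

theorem dI_sup_inf [FiniteDimensional k B] (J J' : Ideal B) :
    dI k (J ⊔ J') + dI k (J ⊓ J') = dI k J + dI k J' := by
  have := Submodule.finrank_sup_add_finrank_inf_eq (J.restrictScalars k) (J'.restrictScalars k)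
  have e : J.restrictScalars k ⊔ J'.restrictScalars k = (J ⊔ J').restrictScalars k := by
    ext x
    simp only [Submodule.mem_sup, Submodule.restrictScalars_mem]
  rw [e] at this
  exact this

theorem dI_top : dI k (⊤ : Ideal B) = finrank k B := by
  unfold dI
  rw [Submodule.restrictScalars_top, finrank_top]

theorem dI_bot : dI k (⊥ : Ideal B) = 0 := by
  unfold dI
  rw [Submodule.restrictScalars_bot, finrank_bot]

theorem dI_le [FiniteDimensional k B] (J : Ideal B) : dI k J ≤ finrank k B := by
  rw [← dI_top]; exact dI_mono le_top

theorem span_eq_range (g : B) : (Ideal.span {g}).restrictScalars k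
    = LinearMap.range (LinearMap.mulLeft k g) := by
  ext x
  simp only [Submodule.restrictScalars_mem, Ideal.mem_span_singleton, LinearMap.mem_range,
    LinearMap.mulLeft_apply]
  constructor
  · rintro ⟨y, rfl⟩; exact ⟨y, rfl⟩
  · rintro ⟨y, rfl⟩; exact ⟨y, rfl⟩

theorem annI_eq_ker (g : B) : (annI g).restrictScalars k
    = LinearMap.ker (LinearMap.mulLeft k g) := by
  ext x
  simp [mem_annI]

theorem NN_add_ann [FiniteDimensional k B] (g : B) : NN k g + dI k (annI g) = finrank k B := by
  unfold NN dI
  rw [span_eq_range, annI_eq_ker]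
  exact LinearMap.finrank_range_add_finrank_ker _

theorem NN_one : NN k (1 : B) = finrank k B := by
  unfold NN
  rw [Ideal.span_singleton_one, dI_top]

theorem NN_le_of_mem [FiniteDimensional k B] {g : B} {J : Ideal B} (h : g ∈ J) : NN k g ≤ dI k J :=
  dI_mono ((Ideal.span_singleton_le_iff_mem J).2 h)

/-- Lemma K -/
theorem NN_add_le [FiniteDimensional k B] {u f g : B} (h : u * (f * g) = 0) :
    NN k (u * g) + NN k (f * g) ≤ NN k g := by
  have h1 := rankNull (k := k) ((Ideal.span {g}).restrictScalars k) (LinearMap.mulLeft k u)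
  have h2 : ((Ideal.span {g}).restrictScalars k).map (LinearMap.mulLeft k u)
      = (Ideal.span {u * g}).restrictScalars k := by
    rw [span_eq_range, span_eq_range, LinearMap.mulLeft_mul, LinearMap.range_comp]
  rw [h2] at h1
  have h3 : (Ideal.span {f * g}).restrictScalars k ≤
      (Ideal.span {g}).restrictScalars k ⊓ LinearMap.ker (LinearMap.mulLeft k u) := by
    intro x hx
    simp only [Submodule.restrictScalars_mem, Ideal.mem_span_singleton, Submodule.mem_inf,
      LinearMap.mem_ker, LinearMap.mulLeft_apply] at *
    obtain ⟨y, rfl⟩ := hx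
    refine ⟨⟨f * y, by ring⟩, ?_⟩
    rw [← mul_assoc, h, zero_mul]
  have h4 := Submodule.finrank_mono h3
  unfold NN dI
  omega

variable [IsAlgClosed k] [FiniteDimensional k B]

theorem exists_sub_ideal (J : Ideal B) (hJ : J ≠ ⊥) : ∃ J' ≤ J, dI k J' + 1 = dI k J := by
  haveI : IsNoetherianRing B := isNoetherian_of_tower k inferInstance
  haveI : Nontrivial J := Submodule.nontrivial_iff_ne_bot.2 hJ
  obtain ⟨M, hM, -⟩ := (eq_top_or_exists_le_coatom (⊥ : Submodule B J)).resolve_left bot_ne_top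
  haveI hs : IsSimpleModule B (J ⧸ M) := isSimpleModule_iff_isCoatom.2 hM
  obtain ⟨m, hm, ⟨e⟩⟩ := isSimpleModule_iff_quot_maximal.1 hs
  have h1 : finrank k (B ⧸ m) = 1 := by
    haveI := hm.isPrime
    have hb := IsAlgClosed.algebraMap_bijective_of_isIntegral (k := k) (K := B ⧸ m)
    have := (LinearEquiv.ofBijective (Algebra.linearMap k (B ⧸ m)) hb).finrank_eq
    rw [← this, finrank_self]
  have h2 : finrank k (J ⧸ M) = 1 := by
    rw [← h1]; exact (e.restrictScalars k).finrank_eq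
  refine ⟨M.map J.subtype, Submodule.map_subtype_le _ _, ?_⟩
  have h3 := Submodule.finrank_quotient_add_finrank (R := k) (M.restrictScalars k)
  have h4 : finrank k (J ⧸ (M.restrictScalars k)) = finrank k (J ⧸ M) := rfl
  have h5 : dI k (M.map J.subtype) = finrank k (M.restrictScalars k) := by
    unfold dI
    have : (M.map J.subtype).restrictScalars k
       = (M.restrictScalars k).map (J.subtype.restrictScalars k) := by
      ext x; simp
    rw [this]
    exact finrank_map_inj (J.subtype.restrictScalars k) J.injective_subtype _
  rw [h5]
  have h6 : dI k J = finrank k J := rfl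
  omega

theorem exists_sub_ideal' (J : Ideal B) (c : ℕ) (hc : c ≤ dI k J) :
    ∃ J' ≤ J, dI k J' + c = dI k J := by
  induction c with
  | zero => exact ⟨J, le_rfl, rfl⟩
  | succ c ih =>
    obtain ⟨J', h1, h2⟩ := ih (by omega)
    have : J' ≠ ⊥ := by
      rintro rfl
      rw [dI_bot] at h2; omega
    obtain ⟨J'', h3, h4⟩ := exists_sub_ideal (k := k) J' this
    exact ⟨J'', h3.trans h1, by omega⟩

/-- Lemma A -/
theorem exists_section (V : Submodule k B) (g : B) (n : ℕ)
    (h : n + 1 ≤ finrank k (V.map (LinearMap.mulLeft k g))) :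
    ∃ f ∈ V, f * g ≠ 0 ∧ NN k (f * g) + n ≤ NN k g := by
  have hle : V.map (LinearMap.mulLeft k g) ≤ (Ideal.span {g}).restrictScalars k := by
    rw [span_eq_range]; exact LinearMap.map_le_range
  have h1 := Submodule.finrank_mono hle
  have h0 : NN k g = finrank k ((Ideal.span {g}).restrictScalars k) := rfl
  obtain ⟨K, hK, hK2⟩ := exists_sub_ideal' (k := k) (Ideal.span {g}) n (by
    change n ≤ NN k g; omega)
  have hK2' : dI k K + n = NN k g := hK2
  obtain ⟨x, hx1, hx2, hx0⟩ := exists_inf _ (K.restrictScalars k) _ hle hK (by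
    change NN k g < _ + dI k K
    omega)
  obtain ⟨f, hf, rfl⟩ := hx1
  simp only [LinearMap.mulLeft_apply] at *
  rw [mul_comm] at hx0 hx2
  refine ⟨f, hf, hx0, ?_⟩
  have := NN_le_of_mem (k := k) (J := K) hx2
  omega

theorem one_dim (W : Submodule k B) (h1 : (1 : B) ∈ W) (hW : Algebra.adjoin k (W : Set B) = ⊤)
    (J : Ideal B) (h : finrank k W ≤ finrank k (W ⊓ J.restrictScalars k : Submodule k B) + 1) :
    finrank k B ≤ dI k J + 1 := by
  by_cases hJ : (1 : B) ∈ J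
  · rw [(Ideal.eq_top_iff_one J).2 hJ, dI_top]; omega
  have hsup : ∀ x : B, x ∈ (k ∙ (1 : B)) ⊔ J.restrictScalars k := by
    have hWle : W ≤ (k ∙ (1 : B)) ⊔ (W ⊓ J.restrictScalars k) := by
      have hle : (k ∙ (1 : B)) ⊔ (W ⊓ J.restrictScalars k) ≤ W :=
        sup_le ((Submodule.span_singleton_le_iff_mem _ _).2 h1) inf_le_left
      refine (Submodule.eq_of_le_of_finrank_le hle ?_).ge
      have hlt : (W ⊓ J.restrictScalars k) < (k ∙ (1 : B)) ⊔ (W ⊓ J.restrictScalars k) := by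
        refine lt_of_le_of_ne le_sup_right ?_
        intro he
        have : (1 : B) ∈ (W ⊓ J.restrictScalars k) := by
          rw [he]; exact Submodule.mem_sup_left (Submodule.mem_span_singleton_self _)
        exact hJ this.2
      have := Submodule.finrank_lt_finrank_of_lt hlt
      omega
    intro x
    have hx : x ∈ Algebra.adjoin k (W : Set B) := by rw [hW]; trivial
    induction hx using Algebra.adjoin_induction with
    | mem x hx => exact (sup_le_sup le_rfl inf_le_right : (k ∙ (1 : B)) ⊔ (W ⊓ J.restrictScalars k) ≤ _) (hWle hx)
    | algebraMap r =>
      refine Submodule.mem_sup_left (Submodule.mem_span_singleton.2 ⟨r, ?_⟩)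
      rw [Algebra.algebraMap_eq_smul_one]
    | add x y _ _ hx hy => exact add_mem hx hy
    | mul x y _ _ hx hy =>
      obtain ⟨a, ha, b, hb, rfl⟩ := Submodule.mem_sup.1 hx
      obtain ⟨α, rfl⟩ := Submodule.mem_span_singleton.1 ha
      rw [add_mul]
      refine add_mem ?_ (Submodule.mem_sup_right (J.mul_mem_right _ hb))
      rw [smul_mul_assoc, one_mul]
      exact Submodule.smul_mem _ _ hy
  have hT : (k ∙ (1 : B)) ⊔ J.restrictScalars k = ⊤ := by
    rw [eq_top_iff]; intro x _; exact hsup x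
  have h2 := Submodule.finrank_sup_add_finrank_inf_eq (k ∙ (1 : B)) (J.restrictScalars k)
  rw [hT, finrank_top] at h2
  have h3 := finrank_span_singleton (K := k) (v := (1 : B)) (by
    intro h0; apply hJ; rw [h0]; exact zero_mem _)
  unfold dI
  omega

/-- `dim gW` versus `W ∩ ann g` -/
theorem mapW (W : Submodule k B) (g : B) :
    finrank k (W.map (LinearMap.mulLeft k g)) +
      finrank k (W ⊓ (annI g).restrictScalars k : Submodule k B) = finrank k W := by
  rw [annI_eq_ker]; exact rankNull W _

/-- F2 -/
theorem F2 (W : Submodule k B) (h1 : (1 : B) ∈ W) (hW : Algebra.adjoin k (W : Set B) = ⊤)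
    (φ : B →ₗ[k] k) (hφ : ∀ x, (∀ y, φ (x * y) = 0) → x = 0) (d : ℕ) :
    ∀ g : B, g ≠ 0 → (∀ w ∈ W ^ d, φ (g * w) = 0) → d + 2 ≤ NN k g := by
  have one_mem : ∀ n : ℕ, (1 : B) ∈ W ^ n := fun n => by
    have := Submodule.pow_mem_pow W h1 n
    rwa [one_pow] at this
  have key : ∀ g : B, g ≠ 0 → φ g = 0 → 2 ≤ finrank k (W.map (LinearMap.mulLeft k g)) := by
    intro g hg hg0
    by_contra hlt
    have h3 := mapW W g
    have h4 := one_dim W h1 hW (annI g) (by omega)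
    have h5 := NN_add_ann (k := k) g
    apply hg
    apply hφ
    intro y
    have h6 : (k ∙ g) = (Ideal.span {g}).restrictScalars k := by
      apply Submodule.eq_of_le_of_finrank_le
      · rw [Submodule.span_singleton_le_iff_mem]
        exact Ideal.mem_span_singleton_self g
      · rw [finrank_span_singleton hg]
        change NN k g ≤ 1
        omega
    have h7 : g * y ∈ (k ∙ g) := by
      rw [h6]; exact Ideal.mul_mem_right _ _ (Ideal.mem_span_singleton_self g)
    obtain ⟨a, ha⟩ := Submodule.mem_span_singleton.1 h7
    rw [← ha, map_smul, hg0, smul_zero]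
  have hle : ∀ g : B, finrank k (W.map (LinearMap.mulLeft k g)) ≤ NN k g := by
    intro g
    apply Submodule.finrank_mono (t := (Ideal.span {g}).restrictScalars k)
    rw [span_eq_range]; exact LinearMap.map_le_range
  induction d with
  | zero =>
    intro g hg hb
    have := key g hg (by simpa using hb 1 (one_mem 0))
    have := hle g
    omega
  | succ d ih =>
    intro g hg hb
    have h2 := key g hg (by simpa using hb 1 (one_mem _))
    obtain ⟨f, hf, hf0, hf1⟩ := exists_section W g 1 h2
    have := ih (f * g) hf0 (by
      intro w hw
      have := hb (f * w) (by rw [pow_succ']; exact Submodule.mul_mem_mul hf hw)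
      rw [← this]; congr 1; ring)
    omega

/-- a linear form with minimal residual scheme -/
theorem exists_min (W : Submodule k B) (g : B)
    (h : 0 < finrank k (W.map (LinearMap.mulLeft k g))) :
    ∃ f ∈ W, f * g ≠ 0 ∧ NN k (f * g) + (finrank k (W.map (LinearMap.mulLeft k g)) - 1) ≤ NN k g
      ∧ ∀ u ∈ W, u * g ≠ 0 → NN k (f * g) ≤ NN k (u * g) := by
  classical
  obtain ⟨f0, hf0, hf1, hf2⟩ := exists_section W g
    (finrank k (W.map (LinearMap.mulLeft k g)) - 1) (by omega)
  have hex : ∃ n, ∃ f ∈ W, f * g ≠ 0 ∧ NN k (f * g) = n := ⟨_, f0, hf0, hf1, rfl⟩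
  obtain ⟨f, hf, hfg, hn⟩ := Nat.find_spec hex
  have hmin : ∀ u ∈ W, u * g ≠ 0 → NN k (f * g) ≤ NN k (u * g) := by
    intro u hu hug
    rw [hn]
    exact Nat.find_min' hex ⟨u, hu, hug, rfl⟩
  refine ⟨f, hf, hfg, ?_, hmin⟩
  have := hmin f0 hf0 hf1
  omega

theorem exists_kill (W : Submodule k B) (f g : B)
    (h : finrank k (W.map (LinearMap.mulLeft k (f * g))) <
      finrank k (W.map (LinearMap.mulLeft k g))) :
    ∃ u ∈ W, u * g ≠ 0 ∧ u * (f * g) = 0 := by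
  rw [LinearMap.mulLeft_mul, Submodule.map_comp] at h
  have h1 := rankNull (W.map (LinearMap.mulLeft k g)) (LinearMap.mulLeft k f)
  obtain ⟨x, ⟨hx1, hx2⟩, hx0⟩ := exists_ne_of_finrank
    (W.map (LinearMap.mulLeft k g) ⊓ LinearMap.ker (LinearMap.mulLeft k f)) (by omega)
  obtain ⟨u, hu, rfl⟩ := hx1
  simp only [LinearMap.mulLeft_apply, LinearMap.mem_ker, SetLike.mem_coe] at *
  refine ⟨u, hu, by rwa [mul_comm], ?_⟩
  rw [← hx2]; ring

/-- F3 -/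
theorem F3 (W : Submodule k B) (h1 : (1 : B) ∈ W) (hW : Algebra.adjoin k (W : Set B) = ⊤)
    (φ : B →ₗ[k] k) (hφ : ∀ x, (∀ y, φ (x * y) = 0) → x = 0) (d : ℕ) :
    ∀ g : B, g ≠ 0 → (∀ w ∈ W ^ d, φ (g * w) = 0) → NN k g ≤ 2 * d + 1 →
      finrank k (W.map (LinearMap.mulLeft k g)) ≤ 2 := by
  induction d with
  | zero =>
    intro g hg hb hN
    have := F2 W h1 hW φ hφ 0 g hg hb
    omega
  | succ d ih =>
    intro g hg hb hN
    by_contra hlt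
    obtain ⟨f, hf, hfg, hf2, hmin⟩ := exists_min W g (by omega)
    have hb' : ∀ w ∈ W ^ d, φ (f * g * w) = 0 := by
      intro w hw
      have := hb (f * w) (by rw [pow_succ']; exact Submodule.mul_mem_mul hf hw)
      rw [← this]; congr 1; ring
    have h3 := ih (f * g) hfg hb' (by omega)
    obtain ⟨u, hu, hug, hufg⟩ := exists_kill W f g (by omega)
    have h4 := hmin u hu hug
    have h5 := NN_add_le (k := k) hufg
    have h6 := F2 W h1 hW φ hφ d (f * g) hfg hb'
    omega

/-- duality -/
theorem exists_rep (φ : B →ₗ[k] k) (hφ : ∀ x, (∀ y, φ (x * y) = 0) → x = 0) (ψ : B →ₗ[k] k) :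
    ∃ b, ∀ y, ψ y = φ (b * y) := by
  let T : B →ₗ[k] Module.Dual k B := (LinearMap.mul k B).compr₂ φ
  have hT : ∀ b y, T b y = φ (b * y) := fun b y => rfl
  have hinj : Function.Injective T := by
    rw [← LinearMap.ker_eq_bot, LinearMap.ker_eq_bot']
    intro x hx
    apply hφ
    intro y
    rw [← hT, hx]; rfl
  have hsurj := (LinearMap.injective_iff_surjective_of_finrank_eq_finrank
    (Subspace.dual_finrank_eq (K := k) (V := B)).symm).1 hinj
  obtain ⟨b, hb⟩ := hsurj ψ
  exact ⟨b, fun y => by rw [← hT, hb]⟩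

theorem mem_span_of_ann (φ : B →ₗ[k] k) (hφ : ∀ x, (∀ y, φ (x * y) = 0) → x = 0) (f u : B)
    (h : annI f ≤ annI u) : u ∈ Ideal.span {f} := by
  have hr := LinearMap.range_dualMap_eq_dualAnnihilator_ker (LinearMap.mulLeft k f)
  have hm : φ ∘ₗ LinearMap.mulLeft k u ∈ (LinearMap.ker (LinearMap.mulLeft k f)).dualAnnihilator := by
    rw [Submodule.mem_dualAnnihilator]
    intro w hw
    have : u * w = 0 := h hw
    simp [this]
  rw [← hr] at hm
  obtain ⟨ψ, hψ⟩ := hm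
  obtain ⟨b, hb⟩ := exists_rep φ hφ ψ
  rw [Ideal.mem_span_singleton]
  refine ⟨b, ?_⟩
  rw [← sub_eq_zero]
  apply hφ
  intro y
  have h1 : φ (u * y) = ψ (f * y) := by
    have := LinearMap.congr_fun hψ y
    simpa using this.symm
  rw [sub_mul, map_sub, h1, hb, sub_eq_zero]
  congr 1; ring

/-- pairing inequality -/
theorem pairing (φ : B →ₗ[k] k) (hφ : ∀ x, (∀ y, φ (x * y) = 0) → x = 0) (G : B)
    (A C : Submodule k B) (h : ∀ a ∈ A, ∀ c ∈ C, φ (G * (a * c)) = 0) :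
    finrank k (A.map (LinearMap.mulLeft k G)) + finrank k (C.map (LinearMap.mulLeft k G))
      ≤ NN k G := by
  let T : B →ₗ[k] Module.Dual k B := (LinearMap.mul k B).compr₂ φ
  have hT : ∀ b y, T b y = φ (b * y) := fun b y => rfl
  have hinj : Function.Injective T := by
    rw [← LinearMap.ker_eq_bot, LinearMap.ker_eq_bot']
    intro x hx
    apply hφ
    intro y
    rw [← hT, hx]; rfl
  have h1 : (C.map (LinearMap.mulLeft k G)).map T ≤
      (A ⊔ (annI G).restrictScalars k).dualAnnihilator := by
    rintro _ ⟨_, ⟨c, hc, rfl⟩, rfl⟩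
    rw [Submodule.mem_dualAnnihilator]
    intro w hw
    obtain ⟨a, ha, z, hz, rfl⟩ := Submodule.mem_sup.1 hw
    rw [hT, LinearMap.mulLeft_apply, mul_add, map_add]
    have hz' : G * z = 0 := hz
    have e1 : G * c * z = c * (G * z) := by ring
    have e2 : G * c * a = G * (a * c) := by ring
    rw [e1, hz', mul_zero, map_zero, e2, h a ha c hc, add_zero]
  have h2 := Submodule.finrank_mono h1
  rw [finrank_map_inj _ hinj] at h2
  have h3 := Subspace.finrank_add_finrank_dualAnnihilator_eq (A ⊔ (annI G).restrictScalars k)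
  have h4 := Submodule.finrank_sup_add_finrank_inf_eq A ((annI G).restrictScalars k)
  have h5 := mapW A G
  have h6 := NN_add_ann (k := k) G
  unfold dI at h6
  omega

end General

section NPsec

theorem small_el {k B : Type*} [Field k] [CommRing B] [Algebra k B] [IsAlgClosed k]
    [FiniteDimensional k B] (W : Submodule k B) (J : Ideal B)
    (h : 2 ≤ finrank k (W ⊓ J.restrictScalars k : Submodule k B)) :
    ∃ u ∈ W, u ∈ J ∧ u ≠ 0 ∧ NN k u + 1 ≤ dI k J := by
  have hJ : J ≠ ⊥ := by
    rintro rfl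
    have h2 : finrank k (W ⊓ (⊥ : Ideal B).restrictScalars k : Submodule k B)
        ≤ dI k (⊥ : Ideal B) := Submodule.finrank_mono inf_le_right
    rw [dI_bot] at h2
    omega
  obtain ⟨J', h1, h2⟩ := exists_sub_ideal (k := k) J hJ
  obtain ⟨x, hx1, hx2, hx0⟩ := exists_inf (W ⊓ J.restrictScalars k) (J'.restrictScalars k)
    (J.restrictScalars k) inf_le_right h1 (by
      change dI k J < _ + dI k J'
      omega)
  have := NN_le_of_mem (k := k) (J := J') hx2
  exact ⟨x, hx1.1, hx1.2, hx0, by omega⟩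

theorem NP_core {k B : Type*} [Field k] [CommRing B] [Algebra k B] [IsAlgClosed k]
    [FiniteDimensional k B]
    (W : Submodule k B) (h1 : (1 : B) ∈ W) (hW : Algebra.adjoin k (W : Set B) = ⊤)
    (φ : B →ₗ[k] k) (hφ : ∀ x, (∀ y, φ (x * y) = 0) → x = 0) (d : ℕ) (hd : 2 ≤ d)
    (hb : ∀ w ∈ W ^ d, φ w = 0) (hN : finrank k B ≤ 3 * d + 1) (hW4 : 4 ≤ finrank k W)
    (noline : ∀ J : Ideal B, finrank k W ≤ finrank k (W ⊓ J.restrictScalars k : Submodule k B) + 2 →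
      finrank k B ≤ dI k J + d + 1)
    (f : B) (hf : f ∈ W) (hf0 : f ≠ 0) (hmin : ∀ u ∈ W, u ≠ 0 → NN k f ≤ NN k u)
    (J : Ideal B) (hJ : finrank k W ≤ finrank k (W ⊓ J.restrictScalars k : Submodule k B) + 2)
    (hJ2 : dI k J + d + 1 ≤ finrank k B) : False := by
  obtain ⟨e, rfl⟩ : ∃ e, d = e + 2 := ⟨d - 2, by omega⟩
  have hb1 : ∀ u ∈ W, ∀ w ∈ W ^ (e + 1), φ (u * w) = 0 := by
    intro u hu w hw
    apply hb
    rw [pow_succ']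
    exact Submodule.mul_mem_mul hu hw
  have hb2 : ∀ u ∈ W, ∀ v ∈ W, ∀ w ∈ W ^ e, φ (u * v * w) = 0 := by
    intro u hu v hv w hw
    rw [mul_assoc]
    apply hb1 u hu
    rw [pow_succ']
    exact Submodule.mul_mem_mul hv hw
  have F2u : ∀ u ∈ W, u ≠ 0 → e + 3 ≤ NN k u := fun u hu hu0 =>
    F2 W h1 hW φ hφ (e + 1) u hu0 (hb1 u hu)
  have F2uv : ∀ u ∈ W, ∀ v ∈ W, u * v ≠ 0 → e + 2 ≤ NN k (u * v) := fun u hu v hv hu0 =>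
    F2 W h1 hW φ hφ e (u * v) hu0 (hb2 u hu v hv)
  have hS : ∀ u ∈ W, u ≠ 0 → NN k u ≤ 2 * e + 3 → NN k u = e + 3 ∧
      finrank k W ≤ finrank k (W ⊓ (annI u).restrictScalars k : Submodule k B) + 2 := by
    intro u hu hu0 hle
    have a1 := F3 W h1 hW φ hφ (e + 1) u hu0 (hb1 u hu) (by omega)
    have a2 := mapW W u
    have a3 := noline (annI u) (by omega)
    have a4 := NN_add_ann (k := k) u
    have a5 := F2u u hu hu0
    omega
  obtain ⟨u1, hu1, hu1J, hu10, hu1N⟩ := small_el W J (by omega)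
  have b1 := hmin u1 hu1 hu10
  have b2 := F2u u1 hu1 hu10
  obtain ⟨hfN, hfU⟩ := hS f hf hf0 (by omega)
  have hfA := NN_add_ann (k := k) f
  -- Claim 1
  have claim1 : ∀ u ∈ W, f * u = 0 → u ≠ 0 → NN k u ≤ 2 * e + 3 →
      W ⊓ (annI u).restrictScalars k = W ⊓ (annI f).restrictScalars k := by
    intro u hu hfu hu0 hule
    obtain ⟨huN, huU⟩ := hS u hu hu0 hule
    have huA := NN_add_ann (k := k) u
    by_contra hne
    set U := W ⊓ (annI f).restrictScalars k with hU
    set U₂ := W ⊓ (annI u).restrictScalars k with hU₂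
    have hsupinf := dI_sup_inf (k := k) (annI f) (annI u)
    have hle : U ⊔ U₂ ≤ W ⊓ (annI f ⊔ annI u).restrictScalars k := by
      refine sup_le (le_inf inf_le_left ?_) (le_inf inf_le_left ?_)
      · intro x hx
        exact (le_sup_left : annI f ≤ annI f ⊔ annI u) (show x ∈ annI f from hx.2)
      · intro x hx
        exact (le_sup_right : annI u ≤ annI f ⊔ annI u) (show x ∈ annI u from hx.2)
    have hfle := Submodule.finrank_mono hle
    have hstrict : finrank k W ≤ finrank k (U ⊔ U₂ : Submodule k B) + 1 := by
      by_cases c : U = U ⊔ U₂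
      · have c2 : U₂ < U ⊔ U₂ := by
          refine lt_of_le_of_ne le_sup_right ?_
          intro h
          exact hne (h.trans c.symm)
        have := Submodule.finrank_lt_finrank_of_lt c2
        omega
      · have c2 : U < U ⊔ U₂ := lt_of_le_of_ne le_sup_left c
        have := Submodule.finrank_lt_finrank_of_lt c2
        omega
    have hod := one_dim W h1 hW (annI f ⊔ annI u) (by omega)
    have hbot : U ⊓ U₂ = ⊥ := by
      by_contra hnb
      obtain ⟨w, hw, hw0⟩ := Submodule.exists_mem_ne_zero_of_ne_bot hnb
      have c1 := F2u w hw.1.1 hw0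
      have c2 := NN_le_of_mem (k := k) (g := w) (J := annI f ⊓ annI u) ⟨hw.1.2, hw.2.2⟩
      omega
    have hdim := Submodule.finrank_sup_add_finrank_inf_eq U U₂
    rw [hbot, finrank_bot] at hdim
    have hsupW : U ⊔ U₂ = W :=
      Submodule.eq_of_le_of_finrank_le (sup_le inf_le_left inf_le_left) (by omega)
    have htop : annI f ⊔ annI u = ⊤ := by
      rw [Ideal.eq_top_iff_one]
      rw [← hsupW] at h1
      exact (hle h1).2
    rw [htop, dI_top] at hsupinf
    have hmul : ∀ a ∈ U, ∀ b ∈ U₂, a * b = 0 := by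
      intro a ha b hb'
      by_contra hab
      have c1 := F2uv a ha.1 b hb'.1 hab
      have c2 := NN_le_of_mem (k := k) (g := a * b) (J := annI f ⊓ annI u)
        ⟨Ideal.mul_mem_right _ _ ha.2, Ideal.mul_mem_left _ _ hb'.2⟩
      omega
    have hJ1 : dI k (Ideal.span (U : Set B)) + (e + 2) + 1 ≥ finrank k B := by
      apply noline
      have : U ≤ W ⊓ (Ideal.span (U : Set B)).restrictScalars k :=
        le_inf inf_le_left (fun x hx => Ideal.subset_span hx)
      have := Submodule.finrank_mono this
      omega
    have hJ2' : dI k (Ideal.span (U₂ : Set B)) + (e + 2) + 1 ≥ finrank k B := by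
      apply noline
      have : U₂ ≤ W ⊓ (Ideal.span (U₂ : Set B)).restrictScalars k :=
        le_inf inf_le_left (fun x hx => Ideal.subset_span hx)
      have := Submodule.finrank_mono this
      omega
    have hprod : Ideal.span (U : Set B) * Ideal.span (U₂ : Set B) = ⊥ := by
      rw [Ideal.span_mul_span', eq_bot_iff, Ideal.span_le]
      rintro _ ⟨a, ha, b, hb', rfl⟩
      exact hmul a ha b hb'
    have hcop : Ideal.span (U : Set B) ⊔ Ideal.span (U₂ : Set B) = ⊤ := by
      rw [Ideal.eq_top_iff_one]
      rw [← hsupW] at h1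
      obtain ⟨a, ha, b, hb', hab⟩ := Submodule.mem_sup.1 h1
      rw [← hab]
      exact add_mem (Ideal.mem_sup_left (Ideal.subset_span ha))
        (Ideal.mem_sup_right (Ideal.subset_span hb'))
    have hinf : Ideal.span (U : Set B) ⊓ Ideal.span (U₂ : Set B) = ⊥ := by
      rw [← Ideal.mul_eq_inf_of_isCoprime (Ideal.isCoprime_iff_sup_eq.2 hcop), hprod]
    have hfin := dI_sup_inf (k := k) (Ideal.span (U : Set B)) (Ideal.span (U₂ : Set B))
    rw [hcop, hinf, dI_top, dI_bot] at hfin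
    omega
  -- Step 5
  obtain ⟨u0, hu0, hu0f, hu00, hu0N⟩ := small_el W (annI f) (by omega)
  have hc := claim1 u0 hu0 hu0f hu00 (by omega)
  have hfU' : f ∈ W ⊓ (annI f).restrictScalars k := by
    rw [← hc]
    refine ⟨hf, ?_⟩
    change u0 * f = 0
    rw [mul_comm]; exact hu0f
  set U := W ⊓ (annI f).restrictScalars k with hU
  have hspan : Ideal.span (U : Set B) = annI f := by
    apply eq_of_dI (k := k)
    · rw [Ideal.span_le]
      intro x hx
      exact hx.2
    · have := noline (Ideal.span (U : Set B)) (by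
        have : U ≤ W ⊓ (Ideal.span (U : Set B)).restrictScalars k :=
          le_inf inf_le_left (fun x hx => Ideal.subset_span hx)
        have := Submodule.finrank_mono this
        omega)
      omega
  have claim2 : ∀ u ∈ U, u ∈ Ideal.span {f} := by
    intro u hu
    by_cases hu0 : u = 0
    · rw [hu0]; exact zero_mem _
    have hfu : f * u = 0 := hu.2
    have hle := NN_le_of_mem (k := k) (g := u) (J := annI f) hu.2
    by_cases hlt : NN k u + 1 ≤ dI k (annI f)
    · have := claim1 u hu.1 hfu hu0 (by omega)
      apply mem_span_of_ann φ hφ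
      rw [← hspan, Ideal.span_le, ← this]
      intro x hx
      exact hx.2
    · have hs : Ideal.span {u} = annI f := by
        apply eq_of_dI (k := k)
        · rw [Ideal.span_singleton_le_iff_mem]; exact hu.2
        · change _ ≤ NN k u
          omega
      by_cases huu : u * u = 0
      · apply mem_span_of_ann φ hφ
        rw [← hs, Ideal.span_singleton_le_iff_mem]
        exact huu
      · exfalso
        have c1 := F2uv u hu.1 u hu.1 huu
        have hfs : f ∈ Ideal.span {u} := by rw [hs]; exact hfU'.2
        obtain ⟨x, hx⟩ := Ideal.mem_span_singleton'.1 hfs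
        have c2 := NN_add_le (k := k) (u := u) (f := x) (g := u) (by
          rw [hx, mul_comm]; exact hfu)
        rw [hx] at c2
        omega
  have hle : annI f ≤ Ideal.span {f} := by
    rw [← hspan, Ideal.span_le]
    exact claim2
  have hle2 : dI k (annI f) ≤ NN k f := dI_mono hle
  omega


theorem quot_functional {k R : Type*} [Field k] [CommRing R] [Algebra k R] (A : Ideal R)
    (ψ : R →ₗ[k] k) (h : ∀ a ∈ A, ψ a = 0) :
    ∃ φ' : (R ⧸ A) →ₗ[k] k, ∀ x, φ' (Ideal.Quotient.mkₐ k A x) = ψ x := by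
  refine ⟨((A.restrictScalars k).liftQ ψ (fun a ha => h a ha)) ∘ₗ
    (Submodule.Quotient.restrictScalarsEquiv k A).symm.toLinearMap, fun x => rfl⟩

theorem finrank_quot {k B : Type*} [Field k] [CommRing B] [Algebra k B]
    [FiniteDimensional k B] (A : Ideal B) : finrank k (B ⧸ A) + dI k A = finrank k B :=
  Submodule.finrank_quotient_add_finrank (R := k) (A.restrictScalars k)

theorem ker_mk {k B : Type*} [Field k] [CommRing B] [Algebra k B] (A : Ideal B) :
    LinearMap.ker (Ideal.Quotient.mkₐ k A).toLinearMap = A.restrictScalars k := by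
  ext x
  simp [Ideal.Quotient.eq_zero_iff_mem]

theorem adjoin_quot {k B : Type*} [Field k] [CommRing B] [Algebra k B] (A : Ideal B)
    (W : Submodule k B) (hW : Algebra.adjoin k (W : Set B) = ⊤) :
    Algebra.adjoin k (W.map (Ideal.Quotient.mkₐ k A).toLinearMap : Set (B ⧸ A)) = ⊤ := by
  have : ((W.map (Ideal.Quotient.mkₐ k A).toLinearMap : Submodule k (B ⧸ A)) : Set (B ⧸ A))
      = (Ideal.Quotient.mkₐ k A) '' (W : Set B) := rfl
  rw [this, ← AlgHom.map_adjoin, hW, Algebra.map_top, AlgHom.range_eq_top]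
  exact Ideal.Quotient.mkₐ_surjective k A

theorem pull_line {k B : Type*} [Field k] [CommRing B] [Algebra k B]
    [FiniteDimensional k B] (W : Submodule k B) (A : Ideal B) (J' : Ideal (B ⧸ A)) :
    finrank k W + finrank k (W.map (Ideal.Quotient.mkₐ k A).toLinearMap ⊓ J'.restrictScalars k :
        Submodule k (B ⧸ A)) ≤
      finrank k (W.map (Ideal.Quotient.mkₐ k A).toLinearMap) +
      finrank k (W ⊓ (J'.comap (Ideal.Quotient.mkₐ k A)).restrictScalars k : Submodule k B) ∧
    dI k (J'.comap (Ideal.Quotient.mkₐ k A)) = dI k J' + dI k A := by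
  set J := J'.comap (Ideal.Quotient.mkₐ k A) with hJ
  have hAJ : A ≤ J := by
    intro x hx
    rw [hJ, Ideal.mem_comap]
    have : Ideal.Quotient.mkₐ k A x = 0 := by
      simp [Ideal.Quotient.eq_zero_iff_mem, hx]
    rw [this]; exact zero_mem _
  have r1 := rankNull W (Ideal.Quotient.mkₐ k A).toLinearMap
  have r2 := rankNull (W ⊓ J.restrictScalars k) (Ideal.Quotient.mkₐ k A).toLinearMap
  have r3 := rankNull (J.restrictScalars k) (Ideal.Quotient.mkₐ k A).toLinearMap
  rw [ker_mk] at r1 r2 r3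
  have e1 : (J.restrictScalars k).map (Ideal.Quotient.mkₐ k A).toLinearMap
      = J'.restrictScalars k := by
    ext y
    constructor
    · rintro ⟨x, hx, rfl⟩; exact hx
    · intro hy
      obtain ⟨x, rfl⟩ := Ideal.Quotient.mkₐ_surjective k A y
      exact ⟨x, hy, rfl⟩
  have e2 : J.restrictScalars k ⊓ A.restrictScalars k = A.restrictScalars k :=
    inf_eq_right.2 hAJ
  have e3 : W ⊓ J.restrictScalars k ⊓ A.restrictScalars k = W ⊓ A.restrictScalars k := by
    rw [inf_assoc, e2]
  have e4 : W.map (Ideal.Quotient.mkₐ k A).toLinearMap ⊓ J'.restrictScalars k ≤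
      (W ⊓ J.restrictScalars k).map (Ideal.Quotient.mkₐ k A).toLinearMap := by
    rintro _ ⟨⟨x, hx, rfl⟩, hy⟩
    exact ⟨x, ⟨hx, hy⟩, rfl⟩
  have e5 := Submodule.finrank_mono e4
  rw [e1, e2] at r3
  rw [e3] at r2
  constructor
  · omega
  · exact r3.symm

universe u v

theorem NP (k : Type v) [Field k] [IsAlgClosed k] (d : ℕ) :
    ∀ (B : Type u) [CommRing B] [Algebra k B] [FiniteDimensional k B] [Nontrivial B]
    (W : Submodule k B) (_ : (1 : B) ∈ W) (_ : Algebra.adjoin k (W : Set B) = ⊤)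
    (φ : B →ₗ[k] k) (_ : ∀ x, (∀ y, φ (x * y) = 0) → x = 0)
    (_ : ∀ w ∈ W ^ d, φ w = 0) (_ : finrank k B ≤ 3 * d + 1),
    (∃ J : Ideal B, finrank k W ≤ finrank k (W ⊓ J.restrictScalars k : Submodule k B) + 2 ∧
      dI k J + d + 2 ≤ finrank k B) ∨ finrank k W ≤ 3 := by
  induction d with
  | zero =>
    intro B _ _ _ _ W h1 hW φ hφ hb hN
    exfalso
    have := F2 W h1 hW φ hφ 0 1 one_ne_zero (by intro w hw; rw [one_mul]; exact hb w hw)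
    rw [NN_one] at this
    omega
  | succ e ih =>
    intro B _ _ _ _ W h1 hW φ hφ hb hN
    rw [or_iff_not_imp_right]
    intro hW3
    by_contra hno
    have noline : ∀ J : Ideal B,
        finrank k W ≤ finrank k (W ⊓ J.restrictScalars k : Submodule k B) + 2 →
        finrank k B ≤ dI k J + (e + 1) + 1 := by
      intro J hJ
      by_contra hlt
      exact hno ⟨J, hJ, by omega⟩
    by_cases he : e = 0
    · subst he
      apply hW3
      have hle : W ≤ LinearMap.ker φ := by
        intro w hw
        apply hb
        rw [zero_add, pow_one]; exact hw
      have hlt : LinearMap.ker φ < ⊤ := by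
        rw [lt_top_iff_ne_top]
        intro ht
        rw [LinearMap.ker_eq_top] at ht
        apply one_ne_zero (α := B)
        apply hφ
        intro y
        rw [ht]; rfl
      have c1 := Submodule.finrank_mono hle
      have c2 := Submodule.finrank_lt_finrank_of_lt hlt
      rw [finrank_top] at c2
      omega
    have hm1 : W.map (LinearMap.mulLeft k (1 : B)) = W := by
      rw [LinearMap.mulLeft_one]; exact Submodule.map_id W
    obtain ⟨f, hf, hf0, hfN, hmin⟩ := exists_min W (1 : B) (by rw [hm1]; omega)
    rw [hm1, mul_one, NN_one] at hfN
    simp only [mul_one] at hf0 hmin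
    have hbf : ∀ w ∈ W ^ e, φ (f * w) = 0 := by
      intro w hw
      apply hb
      rw [pow_succ']
      exact Submodule.mul_mem_mul hf hw
    have hfA := NN_add_ann (k := k) f
    have hq := finrank_quot (k := k) (annI f)
    have hmW := mapW W f
    suffices hJ : ∃ J : Ideal B,
        finrank k W ≤ finrank k (W ⊓ J.restrictScalars k : Submodule k B) + 2 ∧
        dI k J + (e + 1) + 1 ≤ finrank k B by
      obtain ⟨J, hJ1, hJ2⟩ := hJ
      exact NP_core W h1 hW φ hφ (e + 1) (by omega) hb hN (by omega) noline f hf hf0 hmin J hJ1 hJ2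
    obtain ⟨φ', hφ'⟩ := quot_functional (annI f) (φ ∘ₗ LinearMap.mulLeft k f) (by
      intro a ha
      have : f * a = 0 := ha
      simp [this])
    have hne : annI f ≠ ⊤ := by
      rw [Ideal.ne_top_iff_one]
      intro h
      apply hf0
      simpa using (mem_annI.1 h)
    have : Nontrivial (B ⧸ annI f) := Ideal.Quotient.nontrivial_iff.2 hne
    have hsurj := Ideal.Quotient.mkₐ_surjective k (annI f)
    have hfin : finrank k (W.map (Ideal.Quotient.mkₐ k (annI f)).toLinearMap) =
        finrank k (W.map (LinearMap.mulLeft k f)) := by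
      have := rankNull W (Ideal.Quotient.mkₐ k (annI f)).toLinearMap
      rw [ker_mk] at this
      omega
    rcases ih (B ⧸ annI f) (W.map (Ideal.Quotient.mkₐ k (annI f)).toLinearMap)
      ⟨1, h1, map_one (Ideal.Quotient.mkₐ k (annI f))⟩ (adjoin_quot _ W hW) φ' (by
        intro x hx
        obtain ⟨x, rfl⟩ := hsurj x
        have : f * x = 0 := by
          apply hφ
          intro y
          have := hx (Ideal.Quotient.mkₐ k (annI f) y)
          rw [← map_mul, hφ'] at this
          simpa [mul_assoc] using this
        simpa [Ideal.Quotient.eq_zero_iff_mem] using mem_annI.2 this) (by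
        intro w hw
        rw [← Submodule.map_pow] at hw
        obtain ⟨x, hx, rfl⟩ := hw
        have := hφ' x
        simp only [LinearMap.comp_apply, LinearMap.mulLeft_apply] at this
        exact this.trans (hbf x hx)) (by omega) with ⟨J', hJ1, hJ2⟩ | hle
    · obtain ⟨p1, p2⟩ := pull_line W (annI f) J'
      exact ⟨J'.comap (Ideal.Quotient.mkₐ k (annI f)), by omega, by omega⟩
    · obtain ⟨u, hu, hu0, huf⟩ := exists_kill W f (1 : B) (by rw [mul_one, hm1]; omega)
      have c1 := NN_add_le (k := k) huf
      simp only [mul_one, NN_one] at c1 hu0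
      have c2 := hmin u hu hu0
      have c3 := F3 W h1 hW φ hφ e f hf0 hbf (by omega)
      have c4 := F2 W h1 hW φ hφ e f hf0 hbf
      exact ⟨annI f, by omega, by omega⟩

end NPsec

section Planar

/-- dimension of the space of polynomials of degree `≤ t` in two variables -/
def nn (t : ℕ) : ℕ := (t + 1) * (t + 2) / 2

theorem two_nn (t : ℕ) : 2 * nn t = (t + 1) * (t + 2) := by
  unfold nn
  exact Nat.mul_div_cancel' (Nat.even_mul_succ_self (t + 1)).two_dvd

theorem sum_nn (t : ℕ) : ∑ i ∈ Finset.range (t + 1), (i + 1) = nn t := by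
  have : 2 * ∑ i ∈ Finset.range (t + 1), (i + 1) = 2 * nn t := by
    rw [two_nn]
    induction t with
    | zero => rfl
    | succ t ih => rw [Finset.sum_range_succ, mul_add, ih]; ring
  omega

noncomputable def pairEquiv (t : ℕ) : {n : Fin 2 →₀ ℕ | (n.sum fun _ e => e) ≤ t} ≃
    ((Finset.range (t + 1)).sigma (fun i => Finset.HasAntidiagonal.antidiagonal i)) where
  toFun n := ⟨⟨n.1 0 + n.1 1, (n.1 0, n.1 1)⟩, by
    have := n.2
    rw [Set.mem_ofPred_eq, Finsupp.sum_fintype _ _ (fun _ => rfl), Fin.sum_univ_two] at this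
    simp
    omega⟩
  invFun x := ⟨Finsupp.equivFunOnFinite.symm ![x.1.2.1, x.1.2.2], by
    have := x.2
    rw [Finset.mem_sigma, Finset.HasAntidiagonal.mem_antidiagonal, Finset.mem_range] at this
    rw [Set.mem_ofPred_eq, Finsupp.sum_fintype _ _ (fun _ => rfl), Fin.sum_univ_two]
    simp
    omega⟩
  left_inv n := by
    ext i
    fin_cases i <;> simp
  right_inv := by
    rintro ⟨⟨i, ⟨a, b⟩⟩, h⟩
    rw [Finset.mem_sigma, Finset.HasAntidiagonal.mem_antidiagonal, Finset.mem_range] at h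
    obtain ⟨h1, h2⟩ := h
    simp only at h1 h2
    subst h2
    simp

theorem finrank_Rt (k : Type*) [Field k] (t : ℕ) :
    finrank k (restrictTotalDegree (Fin 2) k t) = nn t := by
  have b := basisRestrictSupport k {n : Fin 2 →₀ ℕ | (n.sum fun _ e => e) ≤ t}
  have := finrank_eq_nat_card_basis b
  rw [Nat.card_congr (pairEquiv t), Nat.card_eq_fintype_card, Fintype.card_coe,
    Finset.card_sigma] at this
  simp only [Finset.Nat.card_antidiagonal] at this
  rw [sum_nn] at this
  exact this


/-- Hilbert function of the residual scheme -/
noncomputable def hG {k B : Type*} [Field k] [CommRing B] [Algebra k B]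
    (π : MvPolynomial (Fin 2) k →ₐ[k] B) (G : B) (t : ℕ) : ℕ :=
  finrank k (((restrictTotalDegree (Fin 2) k t).map π.toLinearMap).map (LinearMap.mulLeft k G))

theorem finrank_mulRt {k : Type*} [Field k] (C : MvPolynomial (Fin 2) k) (hC : C ≠ 0) (t : ℕ) :
    finrank k ((restrictTotalDegree (Fin 2) k t).map (LinearMap.mulLeft k C)) = nn t := by
  rw [finrank_map_inj _ (mul_right_injective₀ hC), finrank_Rt]

theorem hG_rankNull {k B : Type*} [Field k] [CommRing B] [Algebra k B]
    (π : MvPolynomial (Fin 2) k →ₐ[k] B) (G : B) (t : ℕ) :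
    hG π G t + finrank k (restrictTotalDegree (Fin 2) k t ⊓
      LinearMap.ker (LinearMap.mulLeft k G ∘ₗ π.toLinearMap) : Submodule k _) = nn t := by
  unfold hG
  rw [← Submodule.map_comp, rankNull, finrank_Rt]

theorem hG_lower {k B : Type*} [Field k] [CommRing B] [Algebra k B]
    (π : MvPolynomial (Fin 2) k →ₐ[k] B) (G : B) (t : ℕ)
    (C : MvPolynomial (Fin 2) k) (hC : C ≠ 0) (hs : C.totalDegree ≤ t + 1)
    (hdiv : ∀ P : MvPolynomial (Fin 2) k, P.totalDegree ≤ t → G * π P = 0 → C ∣ P) :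
    C.totalDegree * (2 * t + 3) ≤ 2 * hG π G t + C.totalDegree * C.totalDegree := by
  have h := hG_rankNull π G t
  have h2 := two_nn t
  by_cases hst : C.totalDegree ≤ t
  · obtain ⟨a, rfl⟩ := Nat.exists_eq_add_of_le hst
    have h3 : restrictTotalDegree (Fin 2) k (C.totalDegree + a) ⊓
      LinearMap.ker (LinearMap.mulLeft k G ∘ₗ π.toLinearMap) ≤
      (restrictTotalDegree (Fin 2) k a).map (LinearMap.mulLeft k C) := by
      rintro P ⟨hP, hk⟩
      rw [SetLike.mem_coe, mem_restrictTotalDegree] at hP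
      obtain ⟨Q, rfl⟩ := hdiv P hP hk
      by_cases hQ : Q = 0
      · rw [hQ, mul_zero]; exact zero_mem _
      rw [totalDegree_mul_of_isDomain hC hQ] at hP
      refine ⟨Q, ?_, rfl⟩
      rw [SetLike.mem_coe, mem_restrictTotalDegree]
      omega
    have h4 := Submodule.finrank_mono h3
    rw [finrank_mulRt C hC] at h4
    have h5 := two_nn a
    nlinarith
  · have h3 : restrictTotalDegree (Fin 2) k t ⊓
      LinearMap.ker (LinearMap.mulLeft k G ∘ₗ π.toLinearMap) = ⊥ := by
      rw [eq_bot_iff]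
      rintro P ⟨hP, hk⟩
      rw [SetLike.mem_coe, mem_restrictTotalDegree] at hP
      obtain ⟨Q, rfl⟩ := hdiv P hP hk
      by_cases hQ : Q = 0
      · rw [hQ, mul_zero]; exact zero_mem _
      rw [totalDegree_mul_of_isDomain hC hQ] at hP
      omega
    rw [h3, finrank_bot] at h
    have h4 : C.totalDegree = t + 1 := by omega
    rw [h4]
    nlinarith

theorem exists_surj {k B : Type*} [Field k] [CommRing B] [Algebra k B] [FiniteDimensional k B]
    (π : MvPolynomial (Fin 2) k →ₐ[k] B) (hπ : Function.Surjective π) :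
    ∃ t0, ∀ t, t0 ≤ t → (restrictTotalDegree (Fin 2) k t).map π.toLinearMap = ⊤ := by
  obtain ⟨s, hs⟩ := (Module.finite_def.1 (inferInstance : Module.Finite k B))
  choose g hg using hπ
  refine ⟨s.sup (fun b => (g b).totalDegree), fun t ht => ?_⟩
  rw [eq_top_iff, ← hs, Submodule.span_le]
  intro b hb
  refine ⟨g b, ?_, hg b⟩
  rw [SetLike.mem_coe, mem_restrictTotalDegree]
  exact (Finset.le_sup (f := fun b => (g b).totalDegree) hb).trans ht

theorem bezout {k B : Type*} [Field k] [CommRing B] [Algebra k B] [FiniteDimensional k B]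
    (π : MvPolynomial (Fin 2) k →ₐ[k] B) (hπ : Function.Surjective π) (G : B)
    (C D : MvPolynomial (Fin 2) k) (hC : C ≠ 0) (hD : D ≠ 0) (hCD : IsRelPrime C D)
    (hGC : G * π C = 0) (hGD : G * π D = 0) :
    NN k G ≤ C.totalDegree * D.totalDegree := by
  obtain ⟨t0, ht0⟩ := exists_surj π hπ
  set s := C.totalDegree with hs
  set e := D.totalDegree with he
  have h1 := hG_rankNull π G (t0 + s + e)
  have h2 : hG π G (t0 + s + e) = NN k G := by
    unfold hG NN dI
    rw [ht0 _ (by omega), Submodule.map_top, span_eq_range]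
  set A := (restrictTotalDegree (Fin 2) k (t0 + e)).map (LinearMap.mulLeft k C) with hA
  set E := (restrictTotalDegree (Fin 2) k (t0 + s)).map (LinearMap.mulLeft k D) with hE
  have h3 : A ⊔ E ≤ restrictTotalDegree (Fin 2) k (t0 + s + e) ⊓
      LinearMap.ker (LinearMap.mulLeft k G ∘ₗ π.toLinearMap) := by
    refine sup_le ?_ ?_
    · rintro _ ⟨P, hP, rfl⟩
      rw [SetLike.mem_coe, mem_restrictTotalDegree] at hP
      constructor
      · rw [SetLike.mem_coe, mem_restrictTotalDegree]
        have := totalDegree_mul C P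
        simp only [LinearMap.mulLeft_apply]
        omega
      · simp only [SetLike.mem_coe, LinearMap.mem_ker, LinearMap.comp_apply,
          LinearMap.mulLeft_apply, AlgHom.toLinearMap_apply, map_mul]
        rw [← mul_assoc, hGC, zero_mul]
    · rintro _ ⟨P, hP, rfl⟩
      rw [SetLike.mem_coe, mem_restrictTotalDegree] at hP
      constructor
      · rw [SetLike.mem_coe, mem_restrictTotalDegree]
        have := totalDegree_mul D P
        simp only [LinearMap.mulLeft_apply]
        omega
      · simp only [SetLike.mem_coe, LinearMap.mem_ker, LinearMap.comp_apply,
          LinearMap.mulLeft_apply, AlgHom.toLinearMap_apply, map_mul]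
        rw [← mul_assoc, hGD, zero_mul]
  have h4 : A ⊓ E ≤ (restrictTotalDegree (Fin 2) k t0).map (LinearMap.mulLeft k (C * D)) := by
    rintro _ ⟨⟨P, hP, rfl⟩, ⟨Q, hQ, hPQ⟩⟩
    rw [SetLike.mem_coe, mem_restrictTotalDegree] at hP hQ
    simp only [LinearMap.mulLeft_apply] at hPQ ⊢
    have hdvd : C ∣ Q := hCD.dvd_of_dvd_mul_left ⟨P, hPQ⟩
    obtain ⟨T, rfl⟩ := hdvd
    by_cases hT : T = 0
    · rw [← hPQ, hT, mul_zero, mul_zero]; exact zero_mem _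
    rw [totalDegree_mul_of_isDomain hC hT] at hQ
    refine ⟨T, ?_, ?_⟩
    · rw [SetLike.mem_coe, mem_restrictTotalDegree]; omega
    · rw [← hPQ, LinearMap.mulLeft_apply]; ring
  have h5 := Submodule.finrank_mono h3
  have h6 := Submodule.finrank_mono h4
  have h7 := Submodule.finrank_sup_add_finrank_inf_eq A E
  rw [finrank_mulRt _ (mul_ne_zero hC hD)] at h6
  rw [hA, hE, finrank_mulRt _ hC, finrank_mulRt _ hD, ← hA, ← hE] at h7
  have n1 := two_nn (t0 + s + e)
  have n2 := two_nn (t0 + s)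
  have n3 := two_nn (t0 + e)
  have n4 := two_nn t0
  have n5 : nn (t0 + s + e) + nn t0 = nn (t0 + s) + nn (t0 + e) + s * e := by
    have : 2 * (nn (t0 + s + e) + nn t0) = 2 * (nn (t0 + s) + nn (t0 + e) + s * e) := by
      rw [mul_add, mul_add, mul_add, n1, n2, n3, n4]; ring
    omega
  omega

theorem hG_pair {k B : Type*} [Field k] [CommRing B] [Algebra k B] [IsAlgClosed k]
    [FiniteDimensional k B]
    (π : MvPolynomial (Fin 2) k →ₐ[k] B)
    (φ : B →ₗ[k] k) (hφ : ∀ x, (∀ y, φ (x * y) = 0) → x = 0) (G : B) (i j : ℕ)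
    (hb : ∀ P : MvPolynomial (Fin 2) k, P.totalDegree ≤ i + j → φ (G * π P) = 0) :
    hG π G i + hG π G j ≤ NN k G := by
  apply pairing φ hφ
  rintro _ ⟨P, hP, rfl⟩ _ ⟨Q, hQ, rfl⟩
  rw [SetLike.mem_coe, mem_restrictTotalDegree] at hP hQ
  have := hb (P * Q) (by have := totalDegree_mul P Q; omega)
  rw [map_mul π] at this
  exact this

theorem planar {k B : Type*} [Field k] [CommRing B] [Algebra k B] [IsAlgClosed k]
    [FiniteDimensional k B] [Nontrivial B]
    (π : MvPolynomial (Fin 2) k →ₐ[k] B) (hπ : Function.Surjective π)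
    (φ : B →ₗ[k] k) (hφ : ∀ x, (∀ y, φ (x * y) = 0) → x = 0) (d : ℕ) (hd : 6 ≤ d)
    (hb : ∀ P : MvPolynomial (Fin 2) k, P.totalDegree ≤ d → φ (π P) = 0)
    (hN : finrank k B ≤ 3 * d + 1) :
    ∃ C : MvPolynomial (Fin 2) k, C ≠ 0 ∧ π C = 0 ∧ 1 ≤ C.totalDegree ∧ C.totalDegree ≤ 3 ∧
      C.totalDegree * (d + 3) ≤ finrank k B + C.totalDegree * C.totalDegree := by
  classical
  obtain ⟨j, j', hjj, hj1, hj2⟩ : ∃ j j', j + j' = d ∧ j' ≤ j ∧ j ≤ j' + 1 :=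
    ⟨(d + 1) / 2, d / 2, by omega, by omega, by omega⟩
  have hpair := hG_pair π φ hφ 1 j j' (by
    intro P hP; rw [one_mul]; exact hb P (by omega))
  rw [NN_one] at hpair
  have hex0 : ∃ C : MvPolynomial (Fin 2) k, C ≠ 0 ∧ π C = 0 ∧ C.totalDegree ≤ j := by
    by_contra hno
    push Not at hno
    have hz : ∀ t ≤ j, hG π 1 t = nn t := by
      intro t ht
      have h := hG_rankNull π 1 t
      have h3 : restrictTotalDegree (Fin 2) k t ⊓
          LinearMap.ker (LinearMap.mulLeft k 1 ∘ₗ π.toLinearMap) = ⊥ := by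
        rw [eq_bot_iff]
        rintro P ⟨hP, hk⟩
        rw [SetLike.mem_coe, mem_restrictTotalDegree] at hP
        by_contra hP0
        have := hno P hP0 (by simpa using hk)
        omega
      rw [h3, finrank_bot] at h
      exact h
    rw [hz j le_rfl, hz j' hj1] at hpair
    have n1 := two_nn j
    have n2 := two_nn j'
    have : j = j' ∨ j = j' + 1 := by omega
    rcases this with rfl | rfl
    · nlinarith
    · nlinarith
  have hex : ∃ n, ∃ C : MvPolynomial (Fin 2) k, C ≠ 0 ∧ π C = 0 ∧ C.totalDegree = n := by
    obtain ⟨C, h1, h2, -⟩ := hex0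
    exact ⟨_, C, h1, h2, rfl⟩
  obtain ⟨C, hC0, hCπ, hCs⟩ := Nat.find_spec hex
  have hCmin : ∀ P : MvPolynomial (Fin 2) k, P ≠ 0 → π P = 0 → C.totalDegree ≤ P.totalDegree := by
    intro P h1 h2
    rw [hCs]
    exact Nat.find_min' hex ⟨P, h1, h2, rfl⟩
  have hCj : C.totalDegree ≤ j := by
    obtain ⟨P, h1, h2, h3⟩ := hex0
    exact (hCmin P h1 h2).trans h3
  have hC1 : 1 ≤ C.totalDegree := by
    by_contra hlt
    have h0 : C.totalDegree = 0 := by omega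
    have hCC := totalDegree_eq_zero_iff_eq_C.1 h0
    rw [hCC] at hCπ hC0
    rw [← algebraMap_eq, AlgHom.commutes] at hCπ
    rw [map_eq_zero_iff _ (algebraMap k B).injective] at hCπ
    rw [hCπ] at hC0
    simp at hC0
  have hall : ∀ D : MvPolynomial (Fin 2) k, D.totalDegree ≤ j → π D = 0 → C ∣ D := by
    by_contra hno
    push Not at hno
    have hex2 : ∃ n, ∃ D : MvPolynomial (Fin 2) k, D.totalDegree ≤ j ∧ π D = 0 ∧ ¬ C ∣ D ∧
        D.totalDegree = n := by
      obtain ⟨D, h1, h2, h3⟩ := hno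
      exact ⟨_, D, h1, h2, h3, rfl⟩
    obtain ⟨D, hDj, hDπ, hCD, hDe⟩ := Nat.find_spec hex2
    have hDmin : ∀ P : MvPolynomial (Fin 2) k, P.totalDegree < D.totalDegree → π P = 0 → C ∣ P := by
      intro P h1 h2
      by_contra h3
      have : D.totalDegree ≤ P.totalDegree := by
        rw [hDe]
        exact Nat.find_min' hex2 ⟨P, by omega, h2, h3, rfl⟩
      omega
    have hD0 : D ≠ 0 := by
      rintro rfl
      exact hCD (dvd_zero C)
    have hes := hCmin D hD0 hDπ
    obtain ⟨C', D', c, hrel, hcC, hcD⟩ := UniqueFactorizationMonoid.exists_reduced_factors C hC0 D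
    have hc0 : c ≠ 0 := by rintro rfl; rw [zero_mul] at hcC; exact hC0 hcC.symm
    have hC'0 : C' ≠ 0 := by rintro rfl; rw [mul_zero] at hcC; exact hC0 hcC.symm
    have hD'0 : D' ≠ 0 := by rintro rfl; rw [mul_zero] at hcD; exact hD0 hcD.symm
    have dC := totalDegree_mul_of_isDomain hc0 hC'0
    have dD := totalDegree_mul_of_isDomain hc0 hD'0
    rw [hcC] at dC
    rw [hcD] at dD
    have hs' : 1 ≤ C'.totalDegree := by
      by_contra hlt
      have h0 : C'.totalDegree = 0 := by omega
      have hCC := totalDegree_eq_zero_iff_eq_C.1 h0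
      apply hCD
      have hu : IsUnit C' := by
        rw [hCC]
        rw [hCC] at hC'0
        have : coeff 0 C' ≠ 0 := by
          intro h; rw [h] at hC'0; simp at hC'0
        exact (IsUnit.mk0 _ this).map MvPolynomial.C
      rw [← hcC, ← hcD]
      exact mul_dvd_mul_left c hu.dvd
    have hbez := bezout π hπ (π c) C' D' hC'0 hD'0 hrel
      (by rw [← map_mul, hcC, hCπ]) (by rw [← map_mul, hcD, hDπ])
    have hp := hG_pair π φ hφ (π c) (D'.totalDegree - 1) (D'.totalDegree - 1) (by
      intro P hP
      rw [← map_mul]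
      apply hb
      have := totalDegree_mul c P
      omega)
    have hl := hG_lower π (π c) (D'.totalDegree - 1) C' hC'0 (by omega) (by
      intro P hP hk
      rw [← map_mul] at hk
      have := hDmin (c * P) (by have := totalDegree_mul c P; omega) hk
      rw [← hcC] at this
      exact (mul_dvd_mul_iff_left hc0).1 this)
    obtain ⟨e', he'⟩ : ∃ e', D'.totalDegree = e' + 1 := ⟨D'.totalDegree - 1, by omega⟩
    rw [he', Nat.add_sub_cancel] at hl hp
    rw [he'] at hbez
    have : C'.totalDegree ≤ e' + 1 := by omega
    nlinarith
  have l1 := hG_lower π 1 j C hC0 (by omega) (by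
    intro P hP hk
    rw [one_mul] at hk
    exact hall P hP hk)
  have l2 := hG_lower π 1 j' C hC0 (by omega) (by
    intro P hP hk
    rw [one_mul] at hk
    exact hall P (by omega) hk)
  have hfin : C.totalDegree * (d + 3) ≤ finrank k B + C.totalDegree * C.totalDegree := by
    rw [← hjj]
    nlinarith
  refine ⟨C, hC0, hCπ, hC1, ?_, hfin⟩
  by_contra hlt
  have h4 : 4 ≤ C.totalDegree := by omega
  have h5 : 2 * C.totalDegree ≤ d + 1 := by omega
  obtain ⟨a, ha⟩ := Nat.exists_eq_add_of_le h4
  rw [ha] at hfin h5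
  obtain ⟨b, hb'⟩ := Nat.exists_eq_add_of_le h5
  have : d = 2 * a + 7 + b := by omega
  rw [this] at hfin hN hd
  nlinarith

end Planar

section Final

theorem R1_le {k : Type*} [Field k] {n : ℕ} (S : Submodule k (MvPolynomial (Fin n) k))
    (h1 : (1 : MvPolynomial (Fin n) k) ∈ S) (hX : ∀ i, (X i : MvPolynomial (Fin n) k) ∈ S) :
    restrictTotalDegree (Fin n) k 1 ≤ S := by
  intro P hP
  rw [mem_restrictTotalDegree] at hP
  rw [P.as_sum]
  refine Submodule.sum_mem _ (fun s hs => ?_)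
  have hle := (le_totalDegree hs).trans hP
  rw [Finsupp.sum_fintype _ _ (fun _ => rfl)] at hle
  have hmon : monomial s (coeff s P) = (coeff s P) • monomial s (1 : k) := by
    rw [smul_monomial, smul_eq_mul, mul_one]
  rw [hmon]
  refine Submodule.smul_mem _ _ ?_
  by_cases hs0 : s = 0
  · rw [hs0]; exact h1
  obtain ⟨i, hi⟩ := Finsupp.ne_iff.1 hs0
  have hsi : s = Finsupp.single i 1 := by
    have h2 := Finset.add_sum_erase Finset.univ (fun l => s l) (Finset.mem_univ i)
    ext l
    by_cases hl : l = i
    · subst hl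
      rw [Finsupp.single_eq_same]
      simp only [Finsupp.coe_zero, Pi.zero_apply] at hi
      omega
    · rw [Finsupp.single_eq_of_ne hl]
      have h3 := Finset.single_le_sum (f := fun l => s l) (s := Finset.univ.erase i)
        (fun _ _ => Nat.zero_le _) (Finset.mem_erase.2 ⟨hl, Finset.mem_univ l⟩)
      simp only [Finsupp.coe_zero, Pi.zero_apply] at hi
      omega
  rw [hsi]
  exact hX i

theorem one_mem_R1 {k : Type*} [Field k] {n : ℕ} :
    (1 : MvPolynomial (Fin n) k) ∈ restrictTotalDegree (Fin n) k 1 := by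
  rw [mem_restrictTotalDegree, totalDegree_one]; omega

theorem X_mem_R1 {k : Type*} [Field k] {n : ℕ} (i : Fin n) :
    (X i : MvPolynomial (Fin n) k) ∈ restrictTotalDegree (Fin n) k 1 := by
  rw [mem_restrictTotalDegree, totalDegree_X]

theorem R1_pow {k : Type*} [Field k] {n : ℕ} (d : ℕ) :
    restrictTotalDegree (Fin n) k 1 ^ d ≤ restrictTotalDegree (Fin n) k d := by
  induction d with
  | zero =>
    rw [pow_zero, Submodule.one_le, mem_restrictTotalDegree, totalDegree_one]
  | succ d ih =>
    rw [pow_succ, Submodule.mul_le]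
    intro P hP Q hQ
    have hP' := ih hP
    rw [mem_restrictTotalDegree] at hP' hQ ⊢
    have := totalDegree_mul P Q
    omega

theorem R1_adjoin {k : Type*} [Field k] {n : ℕ} :
    Algebra.adjoin k (restrictTotalDegree (Fin n) k 1 : Set (MvPolynomial (Fin n) k)) = ⊤ := by
  rw [eq_top_iff, ← adjoin_range_X]
  apply Algebra.adjoin_mono
  rintro _ ⟨i, rfl⟩
  exact X_mem_R1 i

theorem map_R1_le {k Q : Type*} [Field k] [CommRing Q] [Algebra k Q] {n : ℕ}
    (ρ : MvPolynomial (Fin n) k →ₐ[k] Q) (S : Submodule k Q) (h1 : (1 : Q) ∈ S)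
    (hX : ∀ i, ρ (X i) ∈ S) : (restrictTotalDegree (Fin n) k 1).map ρ.toLinearMap ≤ S := by
  rw [Submodule.map_le_iff_le_comap]
  apply R1_le
  · rw [Submodule.mem_comap, AlgHom.toLinearMap_apply, map_one]; exact h1
  · intro i; exact hX i

theorem line_params {k Q : Type*} [Field k] [CommRing Q] [Algebra k Q] {n : ℕ}
    (ρ : MvPolynomial (Fin n) k →ₐ[k] Q)
    (h2 : finrank k ((restrictTotalDegree (Fin n) k 1).map ρ.toLinearMap) = 2) :
    ∃ p v : Fin n → k, v ≠ 0 ∧ lineIdeal p v ≤ RingHom.ker ρ := by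
  set V := (restrictTotalDegree (Fin n) k 1).map ρ.toLinearMap with hV
  have h1V : (1 : Q) ∈ V := ⟨1, one_mem_R1, map_one ρ⟩
  have hXV : ∀ i, ρ (X i) ∈ V := fun i => ⟨X i, X_mem_R1 i, rfl⟩
  obtain ⟨i, hi⟩ : ∃ i, ρ (X i) ∉ Submodule.span k ({1} : Set Q) := by
    by_contra hno
    push Not at hno
    have c1 := Submodule.finrank_mono
      (map_R1_le ρ _ (Submodule.mem_span_singleton_self (1 : Q)) hno)
    have c2 := finrank_span_le_card (R := k) ({1} : Set Q)
    simp at c2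
    rw [← hV] at c1
    omega
  have hspan : Submodule.span k ({1, ρ (X i)} : Set Q) = V := by
    apply Submodule.eq_of_le_of_finrank_le
    · rw [Submodule.span_le]
      rintro x (rfl | rfl)
      · exact h1V
      · exact hXV i
    · have a1 : finrank k (Submodule.span k ({1} : Set Q)) = 1 := by
        apply finrank_span_singleton
        intro h0
        apply hi
        rw [← mul_one (ρ (X i)), h0, mul_zero]
        exact zero_mem _
      have a2 : Submodule.span k ({1} : Set Q) < Submodule.span k ({1, ρ (X i)} : Set Q) := by
        refine lt_of_le_of_ne (Submodule.span_mono (by simp)) ?_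
        intro h
        apply hi
        rw [h]
        exact Submodule.subset_span (by simp)
      have : FiniteDimensional k (Submodule.span k ({1, ρ (X i)} : Set Q)) :=
        FiniteDimensional.span_of_finite k (by simp)
      have a3 := Submodule.finrank_lt_finrank_of_lt a2
      omega
  have hall : ∀ l, ∃ a b : k, a • (1 : Q) + b • ρ (X i) = ρ (X l) := by
    intro l
    have := hXV l
    rw [← hspan] at this
    exact Submodule.mem_span_pair.1 this
  choose p v hpv using hall
  refine ⟨p, v, ?_, ?_⟩
  · rintro rfl
    apply hi
    rw [← hpv i]
    simp only [Pi.zero_apply, zero_smul, add_zero]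
    exact Submodule.smul_mem _ _ (Submodule.mem_span_singleton_self _)
  · have hcomp : ρ = (Polynomial.aeval (ρ (X i))).comp
        (MvPolynomial.aeval (R := k)
          (fun l => Polynomial.C (p l) + Polynomial.C (v l) * Polynomial.X)) := by
      apply algHom_ext
      intro l
      rw [AlgHom.comp_apply, aeval_X, map_add, map_mul, Polynomial.aeval_C, Polynomial.aeval_C,
        Polynomial.aeval_X, ← hpv l, Algebra.algebraMap_eq_smul_one, Algebra.smul_def (v l)]
    intro P hP
    unfold lineIdeal at hP
    rw [RingHom.mem_ker] at hP ⊢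
    rw [hcomp, AlgHom.comp_apply, hP, map_zero]

theorem plane_params {k Q : Type*} [Field k] [CommRing Q] [Algebra k Q] {n : ℕ}
    (ρ : MvPolynomial (Fin n) k →ₐ[k] Q)
    (h3 : finrank k ((restrictTotalDegree (Fin n) k 1).map ρ.toLinearMap) = 3) :
    ∃ (i j : Fin n) (p v₁ v₂ : Fin n → k), LinearIndependent k ![v₁, v₂] ∧
      ρ = (aeval ![ρ (X i), ρ (X j)]).comp (MvPolynomial.aeval (R := k)
    (fun i => MvPolynomial.C (p i) + MvPolynomial.C (v₁ i) * MvPolynomial.X 0 +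
      MvPolynomial.C (v₂ i) * MvPolynomial.X 1) :
      MvPolynomial (Fin n) k →ₐ[k] MvPolynomial (Fin 2) k) ∧
      Submodule.span k ({1, ρ (X i), ρ (X j)} : Set Q) =
        (restrictTotalDegree (Fin n) k 1).map ρ.toLinearMap := by
  set V := (restrictTotalDegree (Fin n) k 1).map ρ.toLinearMap with hV
  have h1V : (1 : Q) ∈ V := ⟨1, one_mem_R1, map_one ρ⟩
  have hXV : ∀ i, ρ (X i) ∈ V := fun i => ⟨X i, X_mem_R1 i, rfl⟩
  obtain ⟨i, hi⟩ : ∃ i, ρ (X i) ∉ Submodule.span k ({1} : Set Q) := by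
    by_contra hno
    push Not at hno
    have c1 := Submodule.finrank_mono
      (map_R1_le ρ _ (Submodule.mem_span_singleton_self (1 : Q)) hno)
    have c2 := finrank_span_le_card (R := k) ({1} : Set Q)
    simp at c2
    rw [← hV] at c1
    omega
  have hfd : ∀ s : Set Q, s.Finite → FiniteDimensional k (Submodule.span k s) :=
    fun s hs => FiniteDimensional.span_of_finite k hs
  have := hfd {1, ρ (X i)} (by simp)
  obtain ⟨j, hj⟩ : ∃ j, ρ (X j) ∉ Submodule.span k ({1, ρ (X i)} : Set Q) := by
    by_contra hno
    push Not at hno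
    have c1 := Submodule.finrank_mono
      (map_R1_le ρ _ (Submodule.subset_span (by simp)) hno)
    classical
    have c2 := finrank_span_finset_le_card (R := k) ({1, ρ (X i)} : Finset Q)
    have c3 := Finset.card_le_two (a := (1 : Q)) (b := ρ (X i))
    rw [Finset.coe_pair] at c2
    unfold Set.finrank at c2
    rw [← hV] at c1
    omega
  have h10 : (1 : Q) ≠ 0 := by
    intro h0
    apply hi
    rw [← mul_one (ρ (X i)), h0, mul_zero]
    exact zero_mem _
  have hspan : Submodule.span k ({1, ρ (X i), ρ (X j)} : Set Q) = V := by
    apply Submodule.eq_of_le_of_finrank_le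
    · rw [Submodule.span_le]
      rintro x (rfl | rfl | rfl)
      · exact h1V
      · exact hXV i
      · exact hXV j
    · have a1 : finrank k (Submodule.span k ({1} : Set Q)) = 1 := finrank_span_singleton h10
      have a2 : Submodule.span k ({1} : Set Q) < Submodule.span k ({1, ρ (X i)} : Set Q) := by
        refine lt_of_le_of_ne (Submodule.span_mono (by simp)) ?_
        intro h
        apply hi
        rw [h]
        exact Submodule.subset_span (by simp)
      have a2' : Submodule.span k ({1, ρ (X i)} : Set Q) <
          Submodule.span k ({1, ρ (X i), ρ (X j)} : Set Q) := by
        refine lt_of_le_of_ne (Submodule.span_mono ?_) ?_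
        · rintro x (rfl | rfl) <;> simp
        intro h
        apply hj
        rw [h]
        exact Submodule.subset_span (by simp)
      have := hfd {1, ρ (X i), ρ (X j)} (by simp)
      have a3 := Submodule.finrank_lt_finrank_of_lt a2
      have a4 := Submodule.finrank_lt_finrank_of_lt a2'
      omega
  have hind : ∀ a b c : k, a • (1 : Q) + b • ρ (X i) + c • ρ (X j) = 0 → b = 0 ∧ c = 0 := by
    intro a b c h
    have hc : c = 0 := by
      by_contra hc
      apply hj
      have e : ρ (X j) = c⁻¹ • (c • ρ (X j)) := by rw [smul_smul, inv_mul_cancel₀ hc, one_smul]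
      have e2 : c • ρ (X j) = -(a • (1 : Q) + b • ρ (X i)) := by
        rw [eq_neg_iff_add_eq_zero, add_comm]; exact h
      rw [e, e2]
      exact Submodule.smul_mem _ _ (neg_mem (Submodule.mem_span_pair.2 ⟨a, b, rfl⟩))
    refine ⟨?_, hc⟩
    by_contra hb
    apply hi
    rw [hc, zero_smul, add_zero] at h
    have e : ρ (X i) = b⁻¹ • (b • ρ (X i)) := by rw [smul_smul, inv_mul_cancel₀ hb, one_smul]
    have e2 : b • ρ (X i) = -(a • (1 : Q)) := by
      rw [eq_neg_iff_add_eq_zero, add_comm]; exact h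
    rw [e, e2]
    exact Submodule.smul_mem _ _ (neg_mem (Submodule.mem_span_singleton.2 ⟨a, rfl⟩))
  have hall : ∀ l, ∃ a b c : k, a • (1 : Q) + b • ρ (X i) + c • ρ (X j) = ρ (X l) := by
    intro l
    have := hXV l
    rw [← hspan] at this
    obtain ⟨a, b, c, h⟩ := Submodule.mem_span_triple.1 this
    exact ⟨a, b, c, h⟩
  choose p v₁ v₂ hpv using hall
  refine ⟨i, j, p, v₁, v₂, ?_, ?_, hspan⟩
  · have ei := hind (p i) (v₁ i - 1) (v₂ i) (by
      have := hpv i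
      rw [sub_smul, one_smul]
      linear_combination this)
    have ej := hind (p j) (v₁ j) (v₂ j - 1) (by
      have := hpv j
      rw [sub_smul, one_smul]
      linear_combination this)
    rw [LinearIndependent.pair_iff]
    intro s t hst
    have hi' := congrFun hst i
    have hj' := congrFun hst j
    simp only [Pi.add_apply, Pi.smul_apply, smul_eq_mul, Pi.zero_apply] at hi' hj'
    have e1 : v₁ i = 1 := by linear_combination ei.1
    have e2 : v₂ j = 1 := by linear_combination ej.2
    rw [e1, ei.2] at hi'
    rw [e2, ej.1] at hj'
    constructor
    · linear_combination hi'
    · linear_combination hj'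
  · apply algHom_ext
    intro l
    simp only [AlgHom.comp_apply, aeval_X, map_add, map_mul, algHom_C]
    rw [← hpv l, Algebra.algebraMap_eq_smul_one, Algebra.smul_def (v₁ l), Algebra.smul_def (v₂ l)]
    simp

theorem finrank_ge {k R Q : Type*} [Field k] [CommRing R] [Algebra k R] [CommRing Q] [Algebra k Q]
    (ρ : R →ₐ[k] Q) (hρ : Function.Surjective ρ) (I A : Ideal R) [FiniteDimensional k (R ⧸ I)]
    (hIA : I ≤ A) (hA : A ≤ RingHom.ker ρ) : finrank k Q ≤ finrank k (R ⧸ A) := by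
  have : FiniteDimensional k (R ⧸ A) :=
    Module.Finite.of_surjective (Ideal.Quotient.factorₐ k hIA).toLinearMap
      (Ideal.Quotient.factor_surjective hIA)
  refine LinearMap.finrank_le_finrank_of_surjective
    (f := (Ideal.Quotient.liftₐ A ρ (fun a ha => hA ha)).toLinearMap) ?_
  intro y
  obtain ⟨x, rfl⟩ := hρ y
  exact ⟨Ideal.Quotient.mk A x, rfl⟩


theorem adjoin_map {k B Q : Type*} [Field k] [CommRing B] [Algebra k B] [CommRing Q] [Algebra k Q]
    (ρ : B →ₐ[k] Q) (hρ : Function.Surjective ρ)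
    (W : Submodule k B) (hW : Algebra.adjoin k (W : Set B) = ⊤) :
    Algebra.adjoin k (W.map ρ.toLinearMap : Set Q) = ⊤ := by
  have : ((W.map ρ.toLinearMap : Submodule k Q) : Set Q) = ρ '' (W : Set B) := rfl
  rw [this, ← AlgHom.map_adjoin, hW, Algebra.map_top, AlgHom.range_eq_top]
  exact hρ

theorem final_abs {k B : Type*} [Field k] [IsAlgClosed k] [CommRing B] [Algebra k B]
    [FiniteDimensional k B] [Nontrivial B] (m d : ℕ) (hd : 6 ≤ d)
    (I : Ideal (MvPolynomial (Fin m) k))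
    [FiniteDimensional k (MvPolynomial (Fin m) k ⧸ I)]
    (ρ : MvPolynomial (Fin m) k →ₐ[k] B) (hρs : Function.Surjective ρ)
    (hker : ∀ P, P ∈ I → ρ P = 0) (hNle : finrank k B ≤ 3 * d + 1)
    (φ : B →ₗ[k] k) (hφ : ∀ x, (∀ y, φ (x * y) = 0) → x = 0)
    (hφd : ∀ P : MvPolynomial (Fin m) k, P.totalDegree ≤ d → φ (ρ P) = 0) :
    (∃ (p v : Fin m → k), v ≠ 0 ∧
      d + 2 ≤ finrank k (MvPolynomial (Fin m) k ⧸ (I ⊔ lineIdeal p v))) ∨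
    (∃ (p v₁ v₂ : Fin m → k) (q : MvPolynomial (Fin 2) k), LinearIndependent k ![v₁, v₂] ∧
      q.totalDegree = 2 ∧
      2 * d + 2 ≤ finrank k (MvPolynomial (Fin m) k ⧸ (I ⊔ planeCurveIdeal p v₁ v₂ q))) ∨
    (∃ (p v₁ v₂ : Fin m → k) (q : MvPolynomial (Fin 2) k), LinearIndependent k ![v₁, v₂] ∧
      q.totalDegree = 3 ∧
      3 * d ≤ finrank k (MvPolynomial (Fin m) k ⧸ (I ⊔ planeCurveIdeal p v₁ v₂ q))) := by
  classical
  set W : Submodule k B := (restrictTotalDegree (Fin m) k 1).map ρ.toLinearMap with hWdef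
  have h1W : (1 : B) ∈ W := ⟨1, one_mem_R1, map_one ρ⟩
  have hWadj : Algebra.adjoin k (W : Set B) = ⊤ := adjoin_map ρ hρs _ R1_adjoin
  have hWd : ∀ w ∈ W ^ d, φ w = 0 := by
    intro w hw
    rw [hWdef, ← Submodule.map_pow] at hw
    obtain ⟨P, hP, rfl⟩ := hw
    refine hφd P ?_
    exact (mem_restrictTotalDegree _ _ _).1 (R1_pow d hP)
  have hF2 := F2 W h1W hWadj φ hφ d 1 one_ne_zero (by
    intro w hw; rw [one_mul]; exact hWd w hw)
  rw [NN_one] at hF2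
  have key : (∃ J : Ideal B,
      finrank k W ≤ finrank k (W ⊓ J.restrictScalars k : Submodule k B) + 2 ∧
      dI k J + d + 2 ≤ finrank k B) ∨ finrank k W = 3 := by
    rcases NP k d B W h1W hWadj φ hφ hWd hNle with h | h
    · exact Or.inl h
    · by_cases h3 : finrank k W = 3
      · exact Or.inr h3
      · refine Or.inl ⟨⊥, by omega, ?_⟩
        rw [dI_bot]; omega
  rcases key with ⟨J, hJ1, hJ2⟩ | h3
  · left
    let ρJ : MvPolynomial (Fin m) k →ₐ[k] B ⧸ J := (Ideal.Quotient.mkₐ k J).comp ρ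
    have hρJs : Function.Surjective ρJ := (Ideal.Quotient.mkₐ_surjective k J).comp hρs
    have hq := finrank_quot (k := k) J
    have hr := rankNull W (Ideal.Quotient.mkₐ k J).toLinearMap
    rw [ker_mk] at hr
    have hmap : (restrictTotalDegree (Fin m) k 1).map ρJ.toLinearMap =
        W.map (Ideal.Quotient.mkₐ k J).toLinearMap := by
      rw [hWdef, ← Submodule.map_comp]; rfl
    have h2 : finrank k ((restrictTotalDegree (Fin m) k 1).map ρJ.toLinearMap) = 2 := by
      rw [hmap]
      by_contra hne2
      have := one_dim W h1W hWadj J (by omega)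
      omega
    obtain ⟨p, v, hv, hle⟩ := line_params ρJ h2
    refine ⟨p, v, hv, ?_⟩
    have := finrank_ge ρJ hρJs I (I ⊔ lineIdeal p v) le_sup_left (sup_le (by
      intro P hP
      rw [RingHom.mem_ker]
      change Ideal.Quotient.mkₐ k J (ρ P) = 0
      rw [hker P hP, map_zero]) hle)
    omega
  · right
    obtain ⟨i, j, p, v₁, v₂, hind, hcomp, hspan⟩ := plane_params ρ h3
    set π : MvPolynomial (Fin 2) k →ₐ[k] B := aeval ![ρ (X i), ρ (X j)] with hπ
    have hπs : Function.Surjective π := by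
      intro y
      obtain ⟨P, rfl⟩ := hρs y
      rw [hcomp]
      exact ⟨_, rfl⟩
    have hren : π = ρ.comp (rename ![i, j]) := by
      apply algHom_ext
      intro l
      fin_cases l <;> simp [hπ]
    obtain ⟨C, hC0, hCπ, hC1, hC3, hCN⟩ := planar π hπs φ hφ d hd (by
      intro P hP
      rw [hren, AlgHom.comp_apply]
      exact hφd _ ((totalDegree_rename_le _ P).trans hP)) hNle
    have hC2 : C.totalDegree ≠ 1 := by
      intro hC
      have hr := rankNull (restrictTotalDegree (Fin 2) k 1) π.toLinearMap
      rw [finrank_Rt] at hr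
      have hle : W ≤ (restrictTotalDegree (Fin 2) k 1).map π.toLinearMap := by
        rw [hWdef, ← hspan, Submodule.span_le]
        rintro x (rfl | rfl | rfl)
        · exact ⟨1, one_mem_R1, map_one π⟩
        · exact ⟨X 0, X_mem_R1 0, by simp [hπ]⟩
        · exact ⟨X 1, X_mem_R1 1, by simp [hπ]⟩
      have hle2 := Submodule.finrank_mono hle
      have hpos : 0 < finrank k (restrictTotalDegree (Fin 2) k 1 ⊓ LinearMap.ker π.toLinearMap :
          Submodule k (MvPolynomial (Fin 2) k)) := by
        rw [Module.finrank_pos_iff, Submodule.nontrivial_iff_ne_bot]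
        intro hbot
        apply hC0
        rw [← Submodule.mem_bot k, ← hbot]
        exact ⟨(mem_restrictTotalDegree _ _ _).2 hC.le, hCπ⟩
      have hn : nn 1 = 3 := rfl
      omega
    have hle : planeCurveIdeal p v₁ v₂ C ≤ RingHom.ker ρ := by
      intro P hP
      unfold planeCurveIdeal at hP
      rw [Ideal.mem_comap, Ideal.mem_span_singleton] at hP
      obtain ⟨Q, hQ⟩ := hP
      rw [RingHom.mem_ker, hcomp, AlgHom.comp_apply, hQ, map_mul, hCπ, zero_mul]
    have hfin := finrank_ge ρ hρs I (I ⊔ planeCurveIdeal p v₁ v₂ C) le_sup_left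
      (sup_le (fun P hP => by rw [RingHom.mem_ker]; exact hker P hP) hle)
    have hdeg23 : C.totalDegree = 2 ∨ C.totalDegree = 3 := by omega
    rcases hdeg23 with h | h
    · left
      rw [h] at hCN
      exact ⟨p, v₁, v₂, C, hind, h, by omega⟩
    · right
      rw [h] at hCN
      exact ⟨p, v₁, v₂, C, hind, h, by omega⟩

theorem socle_reduce {k R : Type*} [Field k] [CommRing R] [Algebra k R] (I : Ideal R)
    [FiniteDimensional k (R ⧸ I)] (N : ℕ) (hdeg : finrank k (R ⧸ I) ≤ N)
    (U : Submodule k R)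
    (h1 : Submodule.map (Ideal.Quotient.mkₐ k I).toLinearMap U ≠ ⊤) :
    ∃ I0 : Ideal R, ∃ φ : (R ⧸ I0) →ₗ[k] k, I ≤ I0 ∧ Nontrivial (R ⧸ I0) ∧
      FiniteDimensional k (R ⧸ I0) ∧ finrank k (R ⧸ I0) ≤ N ∧
      (∀ x, (∀ y, φ (x * y) = 0) → x = 0) ∧
      (∀ P ∈ U, φ (Ideal.Quotient.mkₐ k I0 P) = 0) := by
  classical
  obtain ⟨ψ, hψ0, hψ⟩ := Submodule.exists_le_ker_of_lt_top _ (lt_top_iff_ne_top.2 h1)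
  obtain ⟨φR, hφR⟩ : ∃ φR : R →ₗ[k] k, ∀ P, φR P = ψ (Ideal.Quotient.mkₐ k I P) :=
    ⟨ψ ∘ₗ (Ideal.Quotient.mkₐ k I).toLinearMap, fun _ => rfl⟩
  have hφRd : ∀ P ∈ U, φR P = 0 := by
    intro P hP
    rw [hφR]
    exact hψ ⟨P, hP, rfl⟩
  have hφRI : ∀ P ∈ I, φR P = 0 := by
    intro P hP
    have : Ideal.Quotient.mkₐ k I P = 0 := by
      simpa [Ideal.Quotient.eq_zero_iff_mem] using hP
    rw [hφR, this, map_zero]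
  let I0 : Ideal (R) :=
    { carrier := {g | ∀ h, φR (g * h) = 0}
      add_mem' := by
        intro a b ha hb h
        rw [add_mul, map_add, ha h, hb h, add_zero]
      zero_mem' := by
        intro h
        rw [zero_mul, map_zero]
      smul_mem' := by
        intro c x hx h
        rw [smul_eq_mul, mul_comm c x, mul_assoc]
        exact hx _ }
  have hI0 : ∀ g, g ∈ I0 ↔ ∀ h, φR (g * h) = 0 := fun g => Iff.rfl
  have hII0 : I ≤ I0 := by
    intro g hg
    rw [hI0]
    intro h
    exact hφRI _ (I.mul_mem_right h hg)
  have hne : I0 ≠ ⊤ := by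
    rw [Ideal.ne_top_iff_one]
    intro h
    apply hψ0
    refine LinearMap.ext fun x => ?_
    obtain ⟨P, rfl⟩ := Ideal.Quotient.mkₐ_surjective k I x
    have := (hI0 1).1 h P
    rw [one_mul, hφR] at this
    exact this
  have hnt : Nontrivial (R ⧸ I0) := Ideal.Quotient.nontrivial_iff.2 hne
  have hsurj0 := Ideal.Quotient.factor_surjective hII0
  have hfd : FiniteDimensional k (R ⧸ I0) :=
    Module.Finite.of_surjective (Ideal.Quotient.factorₐ k hII0).toLinearMap hsurj0
  have hNle : finrank k (R ⧸ I0) ≤ N :=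
    (LinearMap.finrank_le_finrank_of_surjective
      (f := (Ideal.Quotient.factorₐ k hII0).toLinearMap) hsurj0).trans hdeg
  obtain ⟨φ, hφ'⟩ := quot_functional I0 φR (by
    intro a ha
    have := (hI0 a).1 ha 1
    rwa [mul_one] at this)
  have hφ : ∀ x, (∀ y, φ (x * y) = 0) → x = 0 := by
    intro x hx
    obtain ⟨P, rfl⟩ := Ideal.Quotient.mkₐ_surjective k I0 x
    have : P ∈ I0 := by
      rw [hI0]
      intro h
      rw [← hφ', map_mul]
      exact hx _
    simpa [Ideal.Quotient.eq_zero_iff_mem] using this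
  exact ⟨I0, φ, hII0, hnt, hfd, hNle, hφ, fun P hP => (hφ' P).trans (hφRd P hP)⟩

end Final

/-- (Lemma 1.) Fix `d ≥ 6`, `m ≥ 2`.  Let `Z ⊂ ℙᵐ` be a zero-dimensional scheme (in an
affine chart, cut out by an ideal `I` with finite-dimensional coordinate ring) with
`deg Z ≤ 3d+1` and `h¹(I_Z(d)) > 0` (restriction of degree-`≤ d` polynomials to `Z` not
surjective).  Then there is a line `L` with `deg(L ∩ Z) ≥ d+2`, or a conic `T` (a degree-2
curve in a plane) with `deg(T ∩ Z) ≥ 2d+2`, or a plane cubic `F` with `deg(F ∩ Z) ≥ 3d`. -/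
theorem stmt10 (k : Type*) [Field k] [IsAlgClosed k] [CharZero k] (m d : ℕ)
    (hd : 6 ≤ d) (hm : 2 ≤ m)
    (I : Ideal (MvPolynomial (Fin m) k))
    [FiniteDimensional k (MvPolynomial (Fin m) k ⧸ I)]
    (hdeg : finrank k (MvPolynomial (Fin m) k ⧸ I) ≤ 3 * d + 1)
    (h1 : Submodule.map (Ideal.Quotient.mkₐ k I).toLinearMap
      (MvPolynomial.restrictTotalDegree (Fin m) k d) ≠ ⊤) :
    (∃ (p v : Fin m → k), v ≠ 0 ∧
      d + 2 ≤ finrank k (MvPolynomial (Fin m) k ⧸ (I ⊔ lineIdeal p v))) ∨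
    (∃ (p v₁ v₂ : Fin m → k) (q : MvPolynomial (Fin 2) k), LinearIndependent k ![v₁, v₂] ∧
      q.totalDegree = 2 ∧
      2 * d + 2 ≤ finrank k (MvPolynomial (Fin m) k ⧸ (I ⊔ planeCurveIdeal p v₁ v₂ q))) ∨
    (∃ (p v₁ v₂ : Fin m → k) (q : MvPolynomial (Fin 2) k), LinearIndependent k ![v₁, v₂] ∧
      q.totalDegree = 3 ∧
      3 * d ≤ finrank k (MvPolynomial (Fin m) k ⧸ (I ⊔ planeCurveIdeal p v₁ v₂ q))) := by
  obtain ⟨I0, φ, hII0, hnt, hfd, hNle, hφ, hφd⟩ := socle_reduce I (3 * d + 1) hdeg _ h1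
  have hker : ∀ P, P ∈ I → Ideal.Quotient.mkₐ k I0 P = 0 := by
    intro P hP
    rw [Ideal.Quotient.mkₐ_eq_mk]
    exact Ideal.Quotient.eq_zero_iff_mem.2 (hII0 hP)
  exact final_abs m d hd I (Ideal.Quotient.mkₐ k I0) (Ideal.Quotient.mkₐ_surjective k I0)
    hker hNle φ hφ (fun P hP => hφd P ((mem_restrictTotalDegree _ _ _).2 hP))
end

section
/- Fix integers d, s, m with 0 ≤ s ≤ m-1 and d ≥ m. Let A₁ ⊂ ℙᵐ be a connected degree-2 zero-dimensional scheme with support O, and S ⊂ ℙᵐ a set of s points with S ∩ A₁ = ∅ such that A = A₁ ∪ S is linearly independent. For any P ∈ ⟨ν_d(A)⟩ with P ∉ ⟨ν_d(A')⟩ for all proper subschemes A' ⊊ A, the symmetric rank of P equals s + d. -/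
open MvPolynomial

/-- A linear form on `k^{m+1}` with coefficient vector `a` (homogeneous coordinates of a
point of `ℙᵐ`); its `d`-th power is the image of the point under the Veronese `ν_d`. -/
noncomputable def linF {k : Type*} [Field k] {n : ℕ} (a : Fin n → k) : MvPolynomial (Fin n) k :=
  ∑ i, MvPolynomial.C (a i) * MvPolynomial.X i

lemma aux_exists_dual {k V ι : Type*} [Field k] [AddCommGroup V] [Module k V] [DecidableEq ι]
    (e : ι → V) (he : LinearIndependent k e) :
    ∃ f : ι → (V →ₗ[k] k), ∀ i j, f i (e j) = if i = j then 1 else 0 := by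
  have h : ∀ i, ∃ g : V →ₗ[k] k, ∀ j, g (e j) = if i = j then 1 else 0 := by
    intro i
    obtain ⟨g, hg⟩ := LinearMap.exists_extend ((Finsupp.lapply i).comp he.repr
      : Submodule.span k (Set.range e) →ₗ[k] k)
    refine ⟨g, fun j => ?_⟩
    have h1 := LinearMap.congr_fun hg ⟨e j, Submodule.subset_span ⟨j, rfl⟩⟩
    have h2 := he.repr_eq_single j ⟨e j, Submodule.subset_span ⟨j, rfl⟩⟩ rfl
    simp only [LinearMap.comp_apply, Submodule.subtype_apply, h2,
      Finsupp.lapply_apply, Finsupp.single_apply] at h1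
    rw [h1]
    simp [eq_comm]
  choose f hf using h
  exact ⟨f, hf⟩

lemma aux_sep {k V : Type*} [Field k] [AddCommGroup V] [Module k V]
    (p : Submodule k V) (v : V) (hv : v ∉ p) : ∃ f : V →ₗ[k] k, f v = 1 ∧ ∀ x ∈ p, f x = 0 := by
  obtain ⟨f, h1, h2⟩ := Submodule.exists_le_ker_of_notMem hv
  refine ⟨(f v)⁻¹ • f, by simp [h1], fun x hx => ?_⟩
  have : f x = 0 := h2 hx
  simp [this]

lemma aux_pick {k ι κ : Type*} [Field k] [Fintype ι] [Fintype κ] [DecidableEq ι] [DecidableEq κ]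
    (w : κ → ι → k) (hw : ∀ t : ι → k, (∀ i, ∑ o, t o * w i o = 0) → t = 0)
    (i0 : κ) (h0 : w i0 ≠ 0) :
    ∃ (J : Finset κ) (t : ι → k), i0 ∉ J ∧ J.card + 1 = Fintype.card ι ∧
      (∀ i ∈ J, ∑ o, t o * w i o = 0) ∧ ∑ o, t o * w i0 o ≠ 0 := by
  classical
  have hexp : ∀ (f : (ι → k) →ₗ[k] k) (x : ι → k), ∑ o, f (Pi.single o 1) * x o = f x := by
    intro f x
    conv_rhs => rw [pi_eq_sum_univ' x]
    rw [map_sum]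
    refine Finset.sum_congr rfl fun o _ => ?_
    rw [map_smul, smul_eq_mul, mul_comm]
  have hli : LinearIndepOn k w {i0} := by
    rw [linearIndepOn_singleton_iff]
    exact h0
  obtain ⟨b, -, hb, hspan, hbi⟩ := exists_linearIndepOn_extension hli (Set.subset_univ _)
  have hi0 : i0 ∈ b := hb rfl
  have htop : Submodule.span k (w '' b) = ⊤ := by
    by_contra hne
    obtain ⟨x, hx⟩ : ∃ x, x ∉ Submodule.span k (w '' b) := by
      by_contra! h
      exact hne (Submodule.eq_top_iff'.2 h)
    obtain ⟨f, hf1, hf2⟩ := aux_sep _ x hx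
    have := hw (fun o => f (Pi.single o 1)) (fun i => by
      rw [hexp]
      exact hf2 _ (hspan ⟨i, trivial, rfl⟩))
    have h3 := hexp f x
    rw [hf1] at h3
    have h4 : ∀ o, f (Pi.single o 1) = 0 := fun o => congrFun this o
    simp [h4] at h3
  have hnot : w i0 ∉ Submodule.span k (w '' (b \ {i0})) := by
    have := linearIndepOn_iff_notMem_span.1 hbi i0 hi0
    exact this
  obtain ⟨f, hf1, hf2⟩ := aux_sep _ _ hnot
  refine ⟨(b \ {i0}).toFinset, fun o => f (Pi.single o 1), by simp, ?_, ?_, ?_⟩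
  · have hB : Fintype.card b = Fintype.card ι := by
      have hbi' : LinearIndependent k (fun x : b => w x) := hbi
      have B := Module.Basis.mk hbi' (by rw [← htop, Set.image_eq_range])
      have := Module.finrank_eq_card_basis B
      rw [← this]
      simp
    rw [← hB, ← Set.toFinset_card, Set.toFinset_sdiff]
    simp only [Set.toFinset_singleton]
    rw [Finset.card_sdiff_of_subset (by simpa using hi0)]
    have : 0 < b.toFinset.card := Finset.card_pos.2 ⟨i0, by simpa using hi0⟩
    simp only [Finset.card_singleton]
    omega
  · intro i hi
    rw [hexp]
    exact hf2 _ (Submodule.subset_span ⟨i, by simpa using hi, rfl⟩)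
  · rw [hexp, hf1]
    exact one_ne_zero

lemma aux_core {k V ι κ : Type*} [Field k] [AddCommGroup V] [Module k V] [Fintype ι] [Fintype κ]
    (n : ℕ) (hn : 1 ≤ n) (e : ι → V) (he : LinearIndependent k e) (a : κ → V) (c : κ → k)
    (f : ι → (V →ₗ[k] k)) (o0 : ι) (hy : ∀ o, f o0 (e o) = 0) (δ : ι → k) (hδ : ∀ o, δ o ≠ 0)
    (H : ∀ (t : ι → k) (L : List (V →ₗ[k] k)), L.length = n →
      ∑ i, c i * (∑ o, t o * f o (a i)) * (L.map (fun g => g (a i))).prod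
        = ∑ o, δ o * t o * (L.map (fun g => g (e o))).prod)
    (hdis : ∀ i o, e o ∉ Submodule.span k {a i}) :
    Fintype.card ι + n ≤ Fintype.card κ := by
  classical
  obtain ⟨φ, hφ⟩ := aux_exists_dual e he
  have hw : ∀ t : ι → k, (∀ i, ∑ o, t o * f o (a i) = 0) → t = 0 := by
    intro t ht
    funext p
    have h := H t (List.replicate n (φ p)) (by simp)
    have h1 : ∀ o, (φ p (e o)) ^ n = if p = o then 1 else 0 := by
      intro o
      rw [hφ]
      split_ifs
      · simp
      · exact zero_pow (by omega)
    simp [ht, h1] at h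
    rcases h with h | h
    · exact absurd h (hδ p)
    · exact h
  obtain ⟨i0, hi0⟩ : ∃ i, f o0 (a i) ≠ 0 := by
    by_contra! h
    have := hw (Pi.single o0 1) (fun i => by simp [Pi.single_apply, h])
    have := congrFun this o0
    simp at this
  obtain ⟨J, t, hJ0, hJc, hJ, ht0⟩ := aux_pick (fun i o => f o (a i)) hw i0
    (fun h => hi0 (congrFun h o0))
  obtain ⟨p, hp⟩ : ∃ p, t p ≠ 0 := by
    by_contra! h
    simp [h] at ht0
  by_contra hlt
  obtain ⟨g0, hg0p, hg0⟩ := aux_sep (Submodule.span k (insert (a i0) (e '' {p}ᶜ))) (e p) (by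
    rw [Submodule.mem_span_insert]
    rintro ⟨x, z, hz, hx⟩
    have hz0 : f o0 z = 0 := by
      have : Submodule.span k (e '' {p}ᶜ) ≤ LinearMap.ker (f o0) := by
        rw [Submodule.span_le]
        rintro _ ⟨o, -, rfl⟩
        exact hy o
      exact this hz
    have h1 := congrArg (f o0) hx
    rw [hy, map_add, map_smul, hz0, smul_eq_mul, add_zero] at h1
    have hx0 : x = 0 := by
      rcases mul_eq_zero.1 h1.symm with h | h
      · exact h
      · exact absurd h hi0
    rw [hx0, zero_smul, zero_add] at hx
    rw [← hx] at hz
    exact (linearIndependent_iff_notMem_span.1 he p) (by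
      rwa [Set.compl_eq_univ_sdiff] at hz))
  have hg : ∀ i, ∃ g : V →ₗ[k] k, g (e p) = 1 ∧ g (a i) = 0 := by
    intro i
    obtain ⟨g, h1, h2⟩ := aux_sep _ _ (hdis i p)
    exact ⟨g, h1, h2 _ (Submodule.mem_span_singleton_self _)⟩
  choose g hg1 hg2 using hg
  set K : Finset κ := (Finset.univ \ J).erase i0 with hK
  have hKc : K.card + 1 + J.card = Fintype.card κ := by
    rw [hK, Finset.card_erase_of_mem (by simp [hJ0]), Finset.card_sdiff_of_subset (by simp)]
    have h1 : (insert i0 J).card ≤ Fintype.card κ := Finset.card_le_univ _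
    rw [Finset.card_insert_of_notMem hJ0] at h1
    rw [Finset.card_univ]
    omega
  have h := H t (K.toList.map g ++ List.replicate (n - K.card) g0) (by simp; omega)
  have hne : n - K.card ≠ 0 := by omega
  rw [Finset.sum_eq_zero, Finset.sum_eq_single p] at h
  · simp only [List.map_append, List.prod_append, List.map_map, List.map_replicate,
      List.prod_replicate, hg0p, Function.comp_def, hg1] at h
    simp [hp, hδ p] at h
  · intro o _ ho
    have : g0 (e o) = 0 := hg0 _ (Submodule.subset_span (Or.inr ⟨o, ho, rfl⟩))
    simp [this, hne]
  · simp
  · intro i _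
    by_cases hiJ : i ∈ J
    · have := hJ i hiJ
      rw [this]; simp
    · by_cases hi : i = i0
      · have : g0 (a i) = 0 := hg0 _ (Submodule.subset_span (Or.inl (by rw [hi])))
        simp [this, hne]
      · have hiK : i ∈ K := by simp [hK, hi, hiJ]
        have : (K.toList.map fun j => (g j) (a i)).prod = 0 := by
          apply List.prod_eq_zero
          rw [List.mem_map]
          exact ⟨i, by simpa using hiK, hg2 i⟩
        simp [Function.comp_def, this]

lemma aux_linF_add {k : Type*} [Field k] {n : ℕ} (a b : Fin n → k) :
    linF (a + b) = linF a + linF b := by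
  simp [linF, add_mul, Finset.sum_add_distrib]

lemma aux_linF_smul {k : Type*} [Field k] {n : ℕ} (c : k) (a : Fin n → k) :
    linF (c • a) = C c * linF a := by
  simp [linF, Finset.mul_sum, mul_assoc]

noncomputable def auxD {k : Type*} [Field k] {n : ℕ} (l : (Fin n → k) →ₗ[k] k) :
    Derivation k (MvPolynomial (Fin n) k) (MvPolynomial (Fin n) k) :=
  MvPolynomial.mkDerivation k (fun i => C (l (Pi.single i 1)))

lemma auxD_linF {k : Type*} [Field k] {n : ℕ} (l : (Fin n → k) →ₗ[k] k) (a : Fin n → k) :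
    auxD l (linF a) = C (l a) := by
  have : l a = ∑ i, a i * l (Pi.single i 1) := by
    conv_lhs => rw [pi_eq_sum_univ' a]
    simp
  rw [this]
  simp [linF, auxD, MvPolynomial.mkDerivation_X, ← MvPolynomial.smul_eq_C_mul]

lemma auxD_linF_pow {k : Type*} [Field k] {n : ℕ} (l : (Fin n → k) →ₗ[k] k) (a : Fin n → k)
    (d : ℕ) : auxD l (linF a ^ (d + 1)) = (((d : k) + 1) * l a) • linF a ^ d := by
  rw [Derivation.leibniz_pow, auxD_linF, MvPolynomial.smul_eq_C_mul]
  simp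
  ring

lemma aux_func {k : Type*} [Field k] {n : ℕ} (L : List ((Fin n → k) →ₗ[k] k)) :
    ∃ Φ : MvPolynomial (Fin n) k →ₗ[k] k, ∀ a, Φ (linF a ^ L.length)
      = (L.length.factorial : k) * (L.map (fun g => g a)).prod := by
  induction L with
  | nil => exact ⟨MvPolynomial.lcoeff k 0, by simp [MvPolynomial.lcoeff]⟩
  | cons l L ih =>
    obtain ⟨Φ, hΦ⟩ := ih
    refine ⟨Φ.comp (auxD l : MvPolynomial (Fin n) k →ₗ[k] MvPolynomial (Fin n) k), fun a => ?_⟩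
    have := auxD_linF_pow l a L.length
    simp only [List.length_cons, LinearMap.comp_apply, Derivation.coeFn_coe, this, map_smul, hΦ,
      List.map_cons, List.prod_cons, Nat.factorial_succ, smul_eq_mul]
    push_cast
    ring

lemma aux_upper {k : Type*} [Field k] [IsAlgClosed k] [CharZero k] {n d : ℕ} (hd : 1 ≤ d)
    (x w : Fin n → k) : ∃ (c : Fin d → k) (a : Fin d → (Fin n → k)),
      linF x ^ (d - 1) * linF w = ∑ i, c i • linF (a i) ^ d := by
  rcases hd.eq_or_lt with rfl | hd2
  · exact ⟨fun _ => 1, fun _ => w, by simp⟩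
  have : NeZero (d : k) := ⟨by simp; omega⟩
  obtain ⟨ζ, hζ⟩ := HasEnoughRootsOfUnity.exists_primitiveRoot k d
  have hdk : (d : k) ≠ 0 := NeZero.ne _
  have hgeo : ∀ j ∈ Finset.range (d + 1), j ≠ d - 1 →
      ∑ i : Fin d, (ζ ^ (i : ℕ)) ^ (j + 1) = 0 := by
    intro j hj hne
    rw [Fin.sum_univ_eq_sum_range (fun i => (ζ ^ i) ^ (j + 1)) d]
    have h1 : ζ ^ (j + 1) ≠ 1 := by
      rw [Ne, hζ.pow_eq_one_iff_dvd]
      rintro ⟨q, hq⟩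
      have : j < d + 1 := Finset.mem_range.1 hj
      rcases q with _ | _ | q
      · omega
      · omega
      · have : d * 2 ≤ d * (q + 1 + 1) := Nat.mul_le_mul_left _ (by omega)
        omega
    have h2 := mul_neg_geom_sum (ζ ^ (j + 1)) d
    rw [← pow_mul, mul_comm (j + 1) d, pow_mul, hζ.pow_eq_one, one_pow, sub_self] at h2
    rcases mul_eq_zero.1 h2 with h | h
    · exact absurd (sub_eq_zero.1 h).symm h1
    · rw [← h]
      refine Finset.sum_congr rfl fun i _ => ?_
      rw [← pow_mul, ← pow_mul, mul_comm]
  refine ⟨fun i => ((d : k) * d)⁻¹ * ζ ^ (i : ℕ), fun i => ζ ^ (i : ℕ) • x + w, ?_⟩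
  have key : ∑ i : Fin d, ζ ^ (i : ℕ) • linF (ζ ^ (i : ℕ) • x + w) ^ d
      = ((d : k) * d) • (linF x ^ (d - 1) * linF w) := by
    have h1 : ∀ i : Fin d, ζ ^ (i : ℕ) • linF (ζ ^ (i : ℕ) • x + w) ^ d
        = ∑ j ∈ Finset.range (d + 1), (ζ ^ (i : ℕ)) ^ (j + 1) •
          (linF x ^ j * linF w ^ (d - j) * (d.choose j : MvPolynomial (Fin n) k)) := by
      intro i
      rw [aux_linF_add, aux_linF_smul, add_pow, Finset.smul_sum]
      refine Finset.sum_congr rfl fun j _ => ?_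
      rw [MvPolynomial.smul_eq_C_mul, MvPolynomial.smul_eq_C_mul]
      simp only [map_pow]
      ring
    rw [Finset.sum_congr rfl fun i _ => h1 i, Finset.sum_comm]
    simp_rw [← Finset.sum_smul]
    rw [Finset.sum_eq_single (d - 1)]
    · have h3 : ∀ i : Fin d, (ζ ^ (i : ℕ)) ^ (d - 1 + 1) = 1 := by
        intro i
        rw [Nat.sub_add_cancel hd, ← pow_mul, mul_comm, pow_mul, hζ.pow_eq_one, one_pow]
      have h4 : d - (d - 1) = 1 := by omega
      have h5 : d.choose (d - 1) = d := by
        obtain ⟨e, rfl⟩ : ∃ e, d = e + 1 := ⟨d - 1, by omega⟩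
        simp
      simp only [h3, h4, h5, MvPolynomial.smul_eq_C_mul]
      simp
      ring
    · intro j hj hne
      rw [hgeo j hj hne, zero_smul]
    · intro h
      exact absurd (Finset.mem_range.2 (by omega)) h
  simp_rw [mul_smul]
  rw [← Finset.smul_sum, key, smul_smul, inv_mul_cancel₀ (mul_ne_zero hdk hdk), one_smul]

lemma aux_sum_sub {α k : Type*} [Field k] [Fintype α] (p : α → Prop) [DecidablePred p]
    (G : α → k) (hG : ∀ o, ¬ p o → G o = 0) : ∑ o : {o // p o}, G o = ∑ o, G o := by
  rw [← Finset.sum_subtype (Finset.univ.filter p) (by simp) G]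
  apply Finset.sum_filter_of_ne
  intro x _ hx
  by_contra h
  exact hx (hG x h)

lemma aux_lower {k : Type*} [Field k] [CharZero k] {N s n : ℕ} (hn : 1 ≤ n)
    (v w : Fin N → k) (u : Fin s → (Fin N → k))
    (hind : LinearIndependent k (Sum.elim ![v, w] u)) (α β : k) (γ : Fin s → k) (hβ : β ≠ 0)
    (hγ : ∀ j, γ j ≠ 0) (r : ℕ) (c : Fin r → k) (a : Fin r → (Fin N → k))
    (hF : α • linF v ^ (n + 1) + β • (linF v ^ n * linF w) + ∑ j, γ j • linF (u j) ^ (n + 1)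
      = ∑ i, c i • linF (a i) ^ (n + 1)) : s + (n + 1) ≤ r := by
  classical
  obtain ⟨φ, hφ⟩ := aux_exists_dual _ hind
  have hn1 : (n : k) + 1 ≠ 0 := by exact_mod_cast Nat.succ_ne_zero n
  -- the basic identity
  have H0 : ∀ l : (Fin N → k) →ₗ[k] k, l v = 0 → ∀ L : List ((Fin N → k) →ₗ[k] k),
      L.length = n → ∑ i, c i * l (a i) * (L.map (fun g => g (a i))).prod
        = β / ((n : k) + 1) * l w * (L.map (fun g => g v)).prod
          + ∑ j, γ j * l (u j) * (L.map (fun g => g (u j))).prod := by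
    intro l hl L hL
    obtain ⟨Φ, hΦ⟩ := aux_func L
    rw [hL] at hΦ
    have h1 := congrArg (fun q => Φ (auxD l q)) hF
    have hvw : auxD l (linF v ^ n * linF w) = l w • linF v ^ n := by
      obtain ⟨n', rfl⟩ : ∃ n', n = n' + 1 := ⟨n - 1, by omega⟩
      rw [Derivation.leibniz, auxD_linF_pow, auxD_linF, hl]
      simp [MvPolynomial.smul_eq_C_mul, mul_comm]
    simp only [map_add, map_sum, Derivation.map_smul, LinearMap.map_smul, hvw, auxD_linF_pow, hΦ, hl, smul_eq_mul] at h1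
    have hfac : (n.factorial : k) ≠ 0 := by exact_mod_cast n.factorial_ne_zero
    have h2 : ((n : k) + 1) * n.factorial *
        ∑ i, c i * l (a i) * (L.map (fun g => g (a i))).prod
        = ((n : k) + 1) * n.factorial * (β / ((n : k) + 1) * l w * (L.map (fun g => g v)).prod
          + ∑ j, γ j * l (u j) * (L.map (fun g => g (u j))).prod) := by
      rw [mul_add, Finset.mul_sum, Finset.mul_sum]
      have e1 : ((n : k) + 1) * n.factorial *
          (β / ((n : k) + 1) * l w * (L.map (fun g => g v)).prod)
          = β * (l w * (n.factorial * (L.map (fun g => g v)).prod)) := by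
        field_simp
      rw [e1]
      have e2 : ∀ (x y z : k), ((n : k) + 1) * n.factorial * (x * y * z)
          = x * (((n : k) + 1) * y * (n.factorial * z)) := by
        intros; ring
      simp only [e2]
      rw [← h1]
      ring
    exact mul_left_cancel₀ (mul_ne_zero hn1 hfac) h2
  set E : Option (Fin s) → (Fin N → k) := fun o => o.elim v u with hE
  set f : Option (Fin s) → ((Fin N → k) →ₗ[k] k) :=
    fun o => o.elim (φ (Sum.inl 1)) (fun j => φ (Sum.inr j)) with hf
  set δ0 : Option (Fin s) → k := fun o => o.elim (β / ((n : k) + 1)) γ with hδ0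
  set χ : Option (Fin s) → k := fun o => o.elim 0 (fun _ => 1) with hχ
  have φv : ∀ i, φ i v = if i = Sum.inl 0 then 1 else 0 := fun i => hφ i (Sum.inl 0)
  have φw : ∀ i, φ i w = if i = Sum.inl 1 then 1 else 0 := fun i => hφ i (Sum.inl 1)
  have φu : ∀ i j, φ i (u j) = if i = Sum.inr j then 1 else 0 := fun i j => hφ i (Sum.inr j)
  have hfE : ∀ o o', f o (E o') = if o = o' then χ o' else 0 := by
    rintro (_ | o) (_ | o') <;> simp [hf, hE, hχ, φv, φu]
  have hEind : LinearIndependent k E := by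
    have hinj : Function.Injective
        (fun o : Option (Fin s) => (o.elim (Sum.inl 0) Sum.inr : Fin 2 ⊕ Fin s)) := by
      rintro (_ | o) (_ | o') <;> simp
    have := hind.comp _ hinj
    convert this using 1
    funext o
    cases o <;> rfl
  have hsum : ∀ (t : Option (Fin s) → k) o', ∑ o, t o * f o (E o') = χ o' * t o' := by
    intro t o'
    simp [hfE, mul_comm]
  have H1 : ∀ (t : Option (Fin s) → k) (L : List ((Fin N → k) →ₗ[k] k)), L.length = n →
      ∑ i, c i * (∑ o, t o * f o (a i)) * (L.map (fun g => g (a i))).prod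
        = ∑ o, δ0 o * t o * (L.map (fun g => g (E o))).prod := by
    intro t L hL
    have hl : ∀ x, (∑ o, t o • f o) x = ∑ o, t o * f o x := by
      intro x
      simp
    have hlv : (∑ o, t o • f o) v = 0 := by
      rw [hl]
      have := hsum t none
      simpa [hχ, hE] using this
    have hlw : (∑ o, t o • f o) w = t none := by
      rw [hl, Fintype.sum_option]
      simp [hf, φw]
    have hlu : ∀ j, (∑ o, t o • f o) (u j) = t (some j) := by
      intro j
      rw [hl]
      have := hsum t (some j)
      simpa [hχ, hE] using this
    have h := H0 _ hlv L hL
    rw [hlw] at h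
    simp only [hlu, hl] at h
    rw [h, Fintype.sum_option]
    simp [hδ0, hE]
  have hσ : ∀ i, ∃ (q : Option (Option (Fin s))) (μ : k),
      (q = none → ∀ o, E o ∉ Submodule.span k {a i}) ∧ ∀ o, q = some o → a i = μ • E o := by
    intro i
    by_cases h : ∃ o, E o ∈ Submodule.span k {a i}
    · obtain ⟨o, ho⟩ := h
      obtain ⟨x, hx⟩ := Submodule.mem_span_singleton.1 ho
      have hx0 : x ≠ 0 := by
        rintro rfl
        rw [zero_smul] at hx
        exact hEind.ne_zero o hx.symm
      refine ⟨some o, x⁻¹, by simp, ?_⟩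
      intro o' ho'
      obtain rfl : o = o' := by simpa using ho'
      rw [← hx, smul_smul, inv_mul_cancel₀ hx0, one_smul]
    · push Not at h
      exact ⟨none, 0, fun _ => h, by simp⟩
  choose σ μ hσ1 hσ2 using hσ
  set δ : Option (Fin s) → k :=
    fun o => δ0 o - χ o * ∑ i with σ i = some o, c i * μ i ^ (n + 1) with hδ
  have H2 : ∀ (t : Option (Fin s) → k) (L : List ((Fin N → k) →ₗ[k] k)), L.length = n →
      ∑ i with σ i = none, c i * (∑ o, t o * f o (a i)) * (L.map (fun g => g (a i))).prod
        = ∑ o, δ o * t o * (L.map (fun g => g (E o))).prod := by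
    intro t L hL
    have h := H1 t L hL
    rw [← Finset.sum_fiberwise Finset.univ σ, Fintype.sum_option] at h
    have h3 : ∀ o, ∑ i with σ i = some o,
        c i * (∑ o, t o * f o (a i)) * (L.map (fun g => g (a i))).prod
        = χ o * (∑ i with σ i = some o, c i * μ i ^ (n + 1)) * t o
          * (L.map (fun g => g (E o))).prod := by
      intro o
      rw [Finset.mul_sum, Finset.sum_mul, Finset.sum_mul]
      refine Finset.sum_congr rfl fun i hi => ?_
      have hi' := hσ2 i o (Finset.mem_filter.1 hi).2
      have e1 : ∑ o, t o * f o (a i) = μ i * (χ o * t o) := by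
        rw [← hsum t o, Finset.mul_sum]
        refine Finset.sum_congr rfl fun o' _ => ?_
        rw [hi', map_smul, smul_eq_mul]
        ring
      have e2 : (L.map (fun g => g (a i))).prod = μ i ^ n * (L.map (fun g => g (E o))).prod := by
        rw [hi', ← hL]
        simp [List.prod_map_mul]
      rw [e1, e2]
      ring
    simp only [h3] at h
    rw [← eq_sub_iff_add_eq] at h
    rw [h, ← Finset.sum_sub_distrib]
    refine Finset.sum_congr rfl fun o _ => ?_
    simp only [hδ]
    ring
  have hδnone : δ none ≠ 0 := by
    simp [hδ, hδ0, hχ, hβ, hn1]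
  have hcore := aux_core (ι := {o // δ o ≠ 0}) (κ := {i // σ i = none}) n hn
    (fun o => E o) (hEind.comp _ Subtype.val_injective) (fun i => a i) (fun i => c i)
    (fun o => f o) ⟨none, hδnone⟩ (by
      rintro ⟨o, ho⟩
      rw [hfE]
      split_ifs with h
      · have h' : o = none := h.symm
        simp [h', hχ]
      · rfl) (fun o => δ o) (fun o => o.2) (by
      intro t L hL
      set t' : Option (Fin s) → k := fun o => if h : δ o ≠ 0 then t ⟨o, h⟩ else 0 with ht'
      have e0 : ∀ o : {o // δ o ≠ 0}, t o = t' o := by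
        intro o
        simp [ht', o.2]
      have h := H2 t' L hL
      simp only [e0]
      rw [aux_sum_sub (fun o => δ o ≠ 0) (fun o => δ o * t' o * (L.map (fun g => g (E o))).prod)
        (by intro o ho; simp [ht', ho])]
      have e1 : ∀ x, ∑ o : {o // δ o ≠ 0}, t' o * f o x = ∑ o, t' o * f o x := by
        intro x
        exact aux_sum_sub (fun o => δ o ≠ 0) (fun o => t' o * f o x)
          (by intro o ho; simp [ht', ho])
      simp only [e1]
      rw [← h]
      exact (Finset.sum_subtype (Finset.univ.filter (fun i => σ i = none)) (by simp)
        (fun i => c i * (∑ o, t' o * f o (a i)) * (L.map (fun g => g (a i))).prod)).symm) (by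
      rintro ⟨i, hi⟩ ⟨o, ho⟩
      exact hσ1 i hi o)
  rw [Fintype.card_subtype, Fintype.card_subtype] at hcore
  have c1 := Finset.card_filter_add_card_filter_not (s := (Finset.univ : Finset (Option (Fin s))))
    (fun o => δ o ≠ 0)
  have c2 := Finset.card_filter_add_card_filter_not (s := (Finset.univ : Finset (Fin r)))
    (fun i => σ i = none)
  have c3 : (Finset.univ.filter (fun o => ¬ δ o ≠ 0)).card
      ≤ (Finset.univ.filter (fun i => ¬ σ i = none)).card := by
    rw [← Finset.card_image_of_injective _ (Option.some_injective _)]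
    refine le_trans (Finset.card_le_card ?_)
      (Finset.card_image_le (s := Finset.univ.filter (fun i => ¬ σ i = none)) (f := σ))
    intro q hq
    obtain ⟨o, ho, rfl⟩ := Finset.mem_image.1 hq
    have ho' : δ o = 0 := by simpa using ho
    by_contra hno
    have hempty : ∀ i, σ i ≠ some o := by
      intro i hi
      exact hno (Finset.mem_image.2 ⟨i, by simp [hi], hi⟩)
    have : δ o = δ0 o := by
      simp only [hδ]
      rw [Finset.sum_eq_zero]
      · simp
      · intro i hi
        exact absurd (Finset.mem_filter.1 hi).2 (hempty i)
    rw [this] at ho'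
    rcases o with _ | j
    · simp [hδ0, hβ, hn1] at ho'
    · exact hγ j (by simpa [hδ0] using ho')
  simp only [Finset.card_univ, Fintype.card_option, Fintype.card_fin] at c1 c2
  omega

/-- (Proposition 1.)  Fix `0 ≤ s ≤ m-1` and `d ≥ m`.  Let `A₁ ⊂ ℙᵐ` be a connected degree-2
zero-dimensional scheme (supported at the point `[vO]` with tangent vector `wT`, so
`⟨ν_d(A₁)⟩ = span{ℓ^d, ℓ^{d-1}·ℓ'}`), and `S = {[u i]}` a set of `s` points disjoint from
`A₁` such that `A = A₁ ∪ S` is linearly independent (the `s+2` coordinate vectors are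
linearly independent).  For any `P = [F] ∈ ⟨ν_d(A)⟩` with `P ∉ ⟨ν_d(A')⟩` for every proper
subscheme `A' ⊊ A`, the symmetric rank of `P` equals `s + d`. -/
theorem stmt17 (k : Type*) [Field k] [IsAlgClosed k] [CharZero k] (m s d : ℕ)
    (hs : s + 1 ≤ m) (hd : m ≤ d)
    (vO wT : Fin (m + 1) → k) (u : Fin s → (Fin (m + 1) → k))
    (hind : LinearIndependent k (Sum.elim ![vO, wT] u))
    (F : MvPolynomial (Fin (m + 1)) k)
    (hF : F ∈ Submodule.span k
      ({linF vO ^ d, linF vO ^ (d - 1) * linF wT} ∪ Set.range fun i => linF (u i) ^ d))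
    (hproper1 : ∀ T : Finset (Fin s), T ≠ Finset.univ →
      F ∉ Submodule.span k
        ({linF vO ^ d, linF vO ^ (d - 1) * linF wT} ∪ (fun i => linF (u i) ^ d) '' ↑T))
    (hproper2 : F ∉ Submodule.span k
      ({linF vO ^ d} ∪ Set.range fun i => linF (u i) ^ d)) :
    (∃ (c : Fin (s + d) → k) (a : Fin (s + d) → (Fin (m + 1) → k)),
      F = ∑ i, c i • linF (a i) ^ d) ∧
    (∀ (r : ℕ) (c : Fin r → k) (a : Fin r → (Fin (m + 1) → k)),
      F = ∑ i, c i • linF (a i) ^ d → s + d ≤ r) := by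
  classical
  have hd1 : 1 ≤ d := by omega
  obtain ⟨α, β, γ, hFe⟩ : ∃ (α β : k) (γ : Fin s → k), α • linF vO ^ d
      + β • (linF vO ^ (d - 1) * linF wT) + ∑ j, γ j • linF (u j) ^ d = F := by
    rw [Submodule.span_union, Submodule.mem_sup] at hF
    obtain ⟨x, hx, y, hy, hxy⟩ := hF
    obtain ⟨α, β, rfl⟩ := Submodule.mem_span_pair.1 hx
    obtain ⟨γ, rfl⟩ := (Submodule.mem_span_range_iff_exists_fun k).1 hy
    exact ⟨α, β, γ, hxy⟩
  have hβ : β ≠ 0 := by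
    rintro rfl
    apply hproper2
    rw [← hFe, zero_smul, add_zero]
    refine Submodule.add_mem _ (Submodule.smul_mem _ _ (Submodule.subset_span (Or.inl rfl))) ?_
    exact Submodule.sum_mem _ fun j _ =>
      Submodule.smul_mem _ _ (Submodule.subset_span (Or.inr ⟨j, rfl⟩))
  have hγ : ∀ j, γ j ≠ 0 := by
    intro j hj
    apply hproper1 (Finset.univ.erase j) (by
      intro h
      have := Finset.mem_univ j
      rw [← h] at this
      simp at this)
    rw [← hFe]
    refine Submodule.add_mem _ (Submodule.add_mem _
      (Submodule.smul_mem _ _ (Submodule.subset_span (Or.inl (Or.inl rfl))))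
      (Submodule.smul_mem _ _ (Submodule.subset_span (Or.inl (Or.inr rfl))))) ?_
    refine Submodule.sum_mem _ fun j' _ => ?_
    by_cases h : j' = j
    · rw [h, hj, zero_smul]
      exact Submodule.zero_mem _
    · exact Submodule.smul_mem _ _ (Submodule.subset_span (Or.inr ⟨j', by simpa using h, rfl⟩))
  constructor
  · obtain ⟨c, a, hca⟩ := aux_upper hd1 vO (α • vO + β • wT)
    refine ⟨Fin.append γ c, Fin.append u a, ?_⟩
    rw [Fin.sum_univ_add]
    simp only [Fin.append_left, Fin.append_right]
    rw [← hca, ← hFe, aux_linF_add, aux_linF_smul, aux_linF_smul]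
    have : linF vO ^ d = linF vO ^ (d - 1) * linF vO := by
      rw [← pow_succ, Nat.sub_add_cancel hd1]
    rw [this, MvPolynomial.smul_eq_C_mul, MvPolynomial.smul_eq_C_mul]
    ring
  · intro r c a hr
    rcases hd1.eq_or_lt with h1 | h2
    · have hs0 : s = 0 := by omega
      by_contra hlt
      have hr0 : r = 0 := by omega
      subst hr0
      apply hproper2
      rw [hr]
      simp
    · obtain ⟨n, rfl⟩ : ∃ n, d = n + 1 := ⟨d - 1, by omega⟩
      rw [Nat.add_sub_cancel] at hFe
      exact aux_lower (by omega) vO wT u hind α β γ hβ hγ r c a (hFe.trans hr)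
end
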